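/- Let (Ω, 𝒜, μ, T) be an aperiodic dynamical system on a standard Borel probability space and let (aₙ) be an increasing sequence of positive reals with aₙ → ∞ and aₙ/n → 0. Then for every ε > 0 there exists a measurable set A ∈ 𝒜 with μ(A) < ε such that for every Borel probability measure ν on ℝ there exists a strictly increasing sequence of positive integers (n_k) for which the laws of (1/a_{n_k}) S_{n_k}(1_A − μ(A)) converge weakly (in distribution) to ν as k → ∞. -/

import Mathlib

open MeasureTheory Filter Topology Set BoundedContinuousFunction

/-- The average of `φ` over the entries of a finite list of rationals. -/
noncomputable def listAverage (l : List ℚ) (φ : ℝ → ℝ) : ℝ :=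
  (∑ i ∈ Finset.range l.length, φ (l.getD i 0 : ℚ)) / l.length

/-- The uniform probability measure on the entries of a finite list of rationals. -/
noncomputable def listMeasure (l : List ℚ) : Measure ℝ :=
  (l.length : ENNReal)⁻¹ • ∑ i ∈ Finset.range l.length, Measure.dirac ((l.getD i 0 : ℚ) : ℝ)

theorem isProbabilityMeasure_listMeasure {l : List ℚ} (hl : l ≠ []) :
    IsProbabilityMeasure (listMeasure l) := by
  refine ⟨?_⟩
  have : (l.length : ENNReal) ≠ 0 := by simpa using hl
  simp [listMeasure, ENNReal.inv_mul_cancel this]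

theorem integral_listMeasure (l : List ℚ) (φ : ℝ → ℝ) :
    ∫ y, φ y ∂(listMeasure l) = listAverage l φ := by
  rw [listMeasure, integral_smul_measure, integral_finsetSum_measure]
  · simp [listAverage, div_eq_inv_mul]
  · exact fun i _ => integrable_dirac (by simp)

theorem tendsto_average_of_shifted_samples {φ : ℝ → ℝ}
    {M : ℝ} (hM : ∀ x, |φ x| ≤ M) {ω y : ℕ → ℝ}
    (hy : ∀ i : ℕ, |φ (y i) - φ (ω i)| ≤ 1 / ((i : ℝ) + 1)) (z : ℕ → ℝ) {I : ℝ}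
    (hω : Tendsto (fun n : ℕ => (∑ i ∈ Finset.range n, φ (ω i)) / n) atTop (𝓝 I)) :
    Tendsto (fun n : ℕ => (∑ i ∈ Finset.range n, φ (y i) + φ (z n)) / ((n + 1 : ℕ) : ℝ))
      atTop (𝓝 I) := by
  have h1 : Tendsto (fun i : ℕ => φ (y i) - φ (ω i)) atTop (𝓝 0) :=
    squeeze_zero_norm hy tendsto_one_div_add_atTop_nhds_zero_nat
  have h2 : Tendsto (fun n : ℕ => (∑ i ∈ Finset.range n, φ (y i)) / n) atTop (𝓝 I) := by
    have := hω.add h1.cesaro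
    rw [add_zero] at this
    refine this.congr fun n => ?_
    rw [Finset.sum_sub_distrib]
    ring
  have h3 : Tendsto (fun n : ℕ => (n : ℝ) / ((n : ℝ) + 1)) atTop (𝓝 1) :=
    tendsto_natCast_div_add_atTop 1
  have h4 : Tendsto (fun n : ℕ => φ (z n) * (1 / ((n : ℝ) + 1))) atTop (𝓝 0) := by
    have h5 : Tendsto (fun i : ℕ => M * (1 / ((i : ℝ) + 1))) atTop (𝓝 0) := by
      simpa using tendsto_one_div_add_atTop_nhds_zero_nat.const_mul M
    refine squeeze_zero_norm (fun i => ?_) h5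
    rw [norm_mul, Real.norm_eq_abs, Real.norm_of_nonneg (by positivity)]
    gcongr
    exact hM _
  have h5 := (h2.mul h3).add h4
  rw [mul_one, add_zero] at h5
  refine h5.congr' ?_
  filter_upwards [eventually_gt_atTop 0] with n hn
  have : (n : ℝ) ≠ 0 := by positivity
  push_cast
  field_simp

theorem strong_law_infinitePi (ν : Measure ℝ) [IsProbabilityMeasure ν] (φ : ℝ →ᵇ ℝ) :
    ∀ᵐ ω ∂(Measure.infinitePi fun _ : ℕ => ν),
      Tendsto (fun n : ℕ => (∑ j ∈ Finset.range n, φ (ω j)) / n) atTop (𝓝 (∫ y, φ y ∂ν)) := by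
  have hm : Measurable φ := φ.continuous.measurable
  have hmp : ∀ j : ℕ, MeasurePreserving (fun ω : ℕ → ℝ => ω j)
      (Measure.infinitePi fun _ : ℕ => ν) ν := fun j =>
    ⟨measurable_pi_apply j, Measure.infinitePi_map_eval (fun _ : ℕ => ν) j⟩
  have hlaw : ∀ j : ℕ, (Measure.infinitePi fun _ : ℕ => ν).map (fun ω => φ (ω j)) = ν.map φ :=
    fun j => by
      have h1 := Measure.map_map (μ := Measure.infinitePi fun _ : ℕ => ν) hm (hmp j).measurable
      rw [(hmp j).map_eq] at h1
      exact h1.symm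
  have key := ProbabilityTheory.strong_law_ae_real (μ := Measure.infinitePi fun _ : ℕ => ν)
    (fun j ω => φ (ω j)) ((hmp 0).integrable_comp_of_integrable (φ.integrable ν))
    (fun j k hjk => (ProbabilityTheory.iIndepFun_infinitePi
      (P := fun _ : ℕ => ν) (X := fun _ => φ) fun _ => hm).indepFun hjk)
    (fun j => ⟨(hm.comp (measurable_pi_apply j)).aemeasurable,
      (hm.comp (measurable_pi_apply 0)).aemeasurable, by rw [hlaw, hlaw]⟩)
  have he := integral_map (hmp 0).aemeasurable (f := φ) hm.aestronglyMeasurable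
  rw [(hmp 0).map_eq] at he
  rwa [he]

theorem exists_list_average_near (ν : Measure ℝ) [IsProbabilityMeasure ν]
    (s : Finset (ℝ →ᵇ ℝ)) {δ : ℝ} (hδ : 0 < δ) :
    ∃ l : List ℚ, l ≠ [] ∧ ∑ i ∈ Finset.range l.length, l.getD i 0 = 0 ∧
      ∀ φ ∈ s, |listAverage l φ - ∫ y, φ y ∂ν| < δ := by
  have hlln : ∀ᵐ ω ∂(Measure.infinitePi fun _ : ℕ => ν), ∀ φ ∈ s,
      Tendsto (fun n : ℕ => (∑ j ∈ Finset.range n, φ (ω j)) / n) atTop (𝓝 (∫ y, φ y ∂ν)) := by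
    rw [Finset.eventually_all]
    exact fun φ _ => strong_law_infinitePi ν φ
  obtain ⟨ω, hω⟩ := hlln.exists
  have hy : ∀ i : ℕ, ∃ q : ℚ, ∀ φ ∈ s, |φ (q : ℝ) - φ (ω i)| ≤ 1 / ((i : ℝ) + 1) := fun i => by
    have h1 : ∀ᶠ x in 𝓝 (ω i), ∀ φ ∈ s, |φ x - φ (ω i)| ≤ 1 / ((i : ℝ) + 1) := by
      rw [Finset.eventually_all]
      intro φ _
      filter_upwards [Metric.tendsto_nhds.1 (φ.continuous.tendsto (ω i)) (1 / ((i : ℝ) + 1))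
        (by positivity)] with x hx
      exact hx.le
    obtain ⟨x, ⟨q, rfl⟩, hx⟩ := (Rat.denseRange_cast (𝕜 := ℝ)).inter_nhds_nonempty h1
    exact ⟨q, hx⟩
  choose y hy using hy
  have hev : ∀ᶠ n : ℕ in atTop, ∀ φ ∈ s,
      |(∑ j ∈ Finset.range n, φ (y j) + φ ((-∑ j ∈ Finset.range n, y j : ℚ) : ℝ))
        / ((n + 1 : ℕ) : ℝ) - ∫ x, φ x ∂ν| < δ := by
    rw [Finset.eventually_all]
    intro φ hφ
    exact (Metric.tendsto_nhds.1 (tendsto_average_of_shifted_samples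
      (fun x => φ.norm_coe_le_norm x) (fun i => hy i φ hφ)
      (fun n => ((-∑ j ∈ Finset.range n, y j : ℚ) : ℝ)) (hω φ hφ))) δ hδ
  obtain ⟨n, hn⟩ := hev.exists
  obtain ⟨l, hl⟩ : ∃ l : List ℚ, l = List.ofFn fun i : Fin (n + 1) =>
    if (i : ℕ) < n then y i else -∑ j ∈ Finset.range n, y j := ⟨_, rfl⟩
  have hlen : l.length = n + 1 := by simp [hl]
  have hget : ∀ i ∈ Finset.range n, l.getD i 0 = y i := fun i hi => by
    have := Finset.mem_range.1 hi
    rw [List.getD_eq_getElem _ _ (by omega)]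
    simp only [hl, List.getElem_ofFn, this, if_true]
  have hgetn : l.getD n 0 = -∑ j ∈ Finset.range n, y j := by
    rw [List.getD_eq_getElem _ _ (by omega)]
    simp only [hl, List.getElem_ofFn, lt_irrefl, if_false]
  refine ⟨l, ?_, ?_, fun φ hφ => ?_⟩
  · rintro rfl
    simp at hlen
  · rw [hlen, Finset.sum_range_succ, hgetn, Finset.sum_congr rfl hget]
    ring
  · rw [listAverage, hlen, Finset.sum_range_succ, hgetn,
      Finset.sum_congr rfl fun j hj => by rw [hget j hj]]
    exact hn φ hφ

theorem exists_enumeration_of_centered_lists :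
    ∃ e : ℕ → List ℚ, (∀ k, e k ≠ [] ∧ ∑ i ∈ Finset.range (e k).length, (e k).getD i 0 = 0) ∧
      ∀ l : List ℚ, l ≠ [] → ∑ i ∈ Finset.range l.length, l.getD i 0 = 0 →
        ∃ᶠ k in atTop, e k = l := by
  let Z := {l : List ℚ // l ≠ [] ∧ ∑ i ∈ Finset.range l.length, l.getD i 0 = 0}
  have : Nonempty (Z × ℕ) := ⟨⟨⟨[0], by simp⟩, 0⟩⟩
  obtain ⟨f, hf⟩ := exists_surjective_nat (Z × ℕ)
  refine ⟨fun k => (f k).1.1, fun k => (f k).1.2, fun l h1 h2 => ?_⟩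
  rw [Nat.frequently_atTop_iff_infinite]
  choose g hg using hf
  refine Set.infinite_of_injective_forall_mem (f := fun i : ℕ => g (⟨l, h1, h2⟩, i))
    (fun i j hij => ?_) fun i => ?_
  · have := congrArg f hij
    simp only [hg] at this
    exact (Prod.mk.inj this).2
  · simp [hg]

theorem mapClusterPt_listMeasure {e : ℕ → List ℚ}
    (he : ∀ l : List ℚ, l ≠ [] → ∑ i ∈ Finset.range l.length, l.getD i 0 = 0 →
        ∃ᶠ k in atTop, e k = l)
    (u : ℕ → ProbabilityMeasure ℝ) (hu : ∀ k, (u k : Measure ℝ) = listMeasure (e k))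
    (ν : ProbabilityMeasure ℝ) : MapClusterPt ν atTop u := by
  let J : (ℝ →ᵇ ℝ) → ProbabilityMeasure ℝ → ℝ := fun φ ρ => ∫ y, φ y ∂(ρ : Measure ℝ)
  have hle : ⨅ φ, comap (J φ) (𝓝 (J φ ν)) ≤ 𝓝 ν := by
    have : Tendsto id (⨅ φ, comap (J φ) (𝓝 (J φ ν))) (𝓝 ν) := by
      rw [ProbabilityMeasure.tendsto_iff_forall_integral_tendsto]
      exact fun φ => tendsto_comap.mono_left (iInf_le (fun φ => comap (J φ) (𝓝 (J φ ν))) φ)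
    exact this
  rw [mapClusterPt_iff_frequently]
  intro s hs
  have hs := hle hs
  rw [(Filter.HasBasis.iInf' fun φ => (Metric.nhds_basis_ball (x := J φ ν)).comap (J φ)).mem_iff]
    at hs
  obtain ⟨⟨S, r⟩, ⟨hS, hr⟩, hsub⟩ := hs
  obtain ⟨δ, hδ, hδr⟩ : ∃ δ > 0, ∀ i ∈ S, δ ≤ r i := by
    rcases S.eq_empty_or_nonempty with rfl | hne
    · exact ⟨1, one_pos, by simp⟩
    · obtain ⟨i0, hi0, hmin⟩ := hS.exists_minimalFor r S hne
      refine ⟨r i0, hr i0 hi0, fun i hi => ?_⟩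
      by_contra! hlt
      exact absurd (hmin hi hlt.le) (not_le.2 hlt)
  obtain ⟨l, hl1, hl2, hl3⟩ := exists_list_average_near (ν : Measure ℝ) hS.toFinset hδ
  refine (he l hl1 hl2).mono fun k hk => hsub ?_
  simp only [mem_iInter, mem_preimage, Metric.mem_ball, Real.dist_eq]
  intro φ hφ
  refine lt_of_lt_of_le ?_ (hδr φ hφ)
  simp only [J, hu, integral_listMeasure, hk]
  exact hl3 φ (hS.mem_toFinset.2 hφ)

/-- A sequence of laws tracking an enumeration that visits every centered list infinitely often
has every probability measure as a subsequential weak limit. -/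
theorem exists_subseq_tendsto_of_tracks_enumeration {e : ℕ → List ℚ} (hne : ∀ k, e k ≠ [])
    (he : ∀ l : List ℚ, l ≠ [] → ∑ i ∈ Finset.range l.length, l.getD i 0 = 0 →
        ∃ᶠ k in atTop, e k = l)
    (u : ℕ → ProbabilityMeasure ℝ)
    (hu : ∀ (φ : ℝ → ℝ) (K : NNReal) (M : ℝ), LipschitzWith K φ → (∀ x, |φ x| ≤ M) →
      Tendsto (fun k => ∫ y, φ y ∂(u k : Measure ℝ) - listAverage (e k) φ) atTop (𝓝 0))
    (ν : ProbabilityMeasure ℝ) :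
    ∃ θ : ℕ → ℕ, StrictMono θ ∧ Tendsto (u ∘ θ) atTop (𝓝 ν) := by
  obtain ⟨θ, hθ, ht⟩ := (mapClusterPt_listMeasure he
    (fun k => ⟨listMeasure (e k), isProbabilityMeasure_listMeasure (hne k)⟩)
    (fun _ => rfl) ν).tendsto_subseq
  refine ⟨θ, hθ, ?_⟩
  rw [tendsto_iff_forall_lipschitz_integral_tendsto] at ht ⊢
  intro φ hb hK
  have h1 := ht φ hb hK
  obtain ⟨C, hC⟩ := hb
  obtain ⟨K, hK⟩ := hK
  have h2 := (hu φ K (|φ 0| + C) hK fun x => by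
    have h1 := hC x 0
    rw [Real.dist_eq] at h1
    have := abs_sub_abs_le_abs_sub (φ x) (φ 0)
    linarith).comp hθ.tendsto_atTop
  have h3 := h2.add h1
  rw [zero_add] at h3
  refine h3.congr fun k => ?_
  change _ - _ + ∫ y, φ y ∂(listMeasure (e (θ k))) = _
  rw [integral_listMeasure]
  simp

theorem measurableSet_forall_mem_finset {Ω : Type*} [MeasurableSpace Ω] (s : Finset ℕ)
    {p : ℕ → Ω → Prop} (h : ∀ i, MeasurableSet {x | p i x}) :
    MeasurableSet {x | ∀ i ∈ s, p i x} := by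
  simp only [ofPred_forall]
  exact s.measurableSet_biInter fun i _ => h i

theorem iterate_leftInverse_add {Ω : Type*} {T S : Ω → Ω} (h : Function.LeftInverse S T)
    (i j : ℕ) (x : Ω) : S^[i] (T^[i + j] x) = T^[j] x := by
  rw [Function.iterate_add_apply, h.iterate i]

theorem pairwise_disjoint_levels {Ω : Type*} {T S : Ω → Ω} (hTS : Function.LeftInverse T S)
    {E : Set Ω} {H : ℕ} (hE : ∀ x ∈ E, ∀ i, 0 < i → i < H → T^[i] x ∉ E) :
    (↑(Finset.range H) : Set ℕ).PairwiseDisjoint fun j => S^[j] ⁻¹' E := by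
  have key : ∀ i j, i < j → j < H → Disjoint (S^[i] ⁻¹' E) (S^[j] ⁻¹' E) := by
    intro i j hij hj
    rw [Set.disjoint_left]
    intro z hi hz
    refine hE _ hz (j - i) (by omega) (by omega) ?_
    have := iterate_leftInverse_add hTS (j - i) i z
    rw [Nat.sub_add_cancel hij.le] at this
    rw [this]
    exact hi
  intro i hi j hj hij
  simp only [Finset.coe_range, mem_Iio] at hi hj
  rcases lt_or_gt_of_ne hij with h | h
  · exact key i j h hj
  · exact (key j i h hi).symm

theorem mul_measure_base_le_one {Ω : Type*} [MeasurableSpace Ω] {μ : Measure Ω}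
    [IsProbabilityMeasure μ] {T S : Ω → Ω} (hS : MeasurePreserving S μ μ)
    (hTS : Function.LeftInverse T S) {E : Set Ω} (hEm : MeasurableSet E) {H : ℕ}
    (hE : ∀ x ∈ E, ∀ i, 0 < i → i < H → T^[i] x ∉ E) : H * μ.real E ≤ 1 := by
  have h1 := measureReal_biUnion_finset (μ := μ) (pairwise_disjoint_levels hTS hE)
    (fun j _ => (hS.iterate j).measurable hEm)
  have h2 : ∀ j ∈ Finset.range H, μ.real (S^[j] ⁻¹' E) = μ.real E := fun j _ => by
    rw [measureReal_def, (hS.iterate j).measure_preimage hEm.nullMeasurableSet, measureReal_def]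
  rw [Finset.sum_congr rfl h2] at h1
  simp only [Finset.sum_const, Finset.card_range, nsmul_eq_mul] at h1
  rw [← h1]
  exact measureReal_le_one

/-- A countable measurable colouring giving distinct colours to points of an aperiodic orbit
that are less than `N` apart. -/
theorem exists_measurable_orbit_coloring {Ω : Type*} [MeasurableSpace Ω] [StandardBorelSpace Ω]
    {T : Ω → Ω} (hT : Measurable T) (N : ℕ) :
    ∃ c : Ω → ℕ, Measurable c ∧
      ∀ x, (∀ n ≥ 1, ∀ m, T^[n] (T^[m] x) ≠ T^[m] x) → ∀ i, 0 < i → i < N → c x ≠ c (T^[i] x) := by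
  classical
  have hf := measurableEmbedding_embeddingReal Ω
  set f := embeddingReal Ω
  obtain ⟨I, hI⟩ := exists_surjective_nat (ℚ × ℚ)
  let U : ℕ → Set Ω := fun k => {x | f x ∈ Ioo ((I k).1 : ℝ) (I k).2 ∧
    ∀ i ∈ Finset.Ioo 0 N, f (T^[i] x) ∉ Ioo ((I k).1 : ℝ) (I k).2}
  have hU : ∀ k, MeasurableSet (U k) := fun k => by
    refine (hf.measurable measurableSet_Ioo).inter ?_
    exact measurableSet_forall_mem_finset _ fun i =>
      ((hf.measurable.comp (hT.iterate i)) measurableSet_Ioo).compl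
  have hcov : ∀ x, (∀ n ≥ 1, T^[n] x ≠ x) → ∃ k, x ∈ U k := by
    intro x hx
    have hev : ∀ᶠ y in 𝓝 (f x), ∀ i ∈ Finset.Ioo 0 N, y ≠ f (T^[i] x) := by
      rw [Finset.eventually_all]
      intro i hi
      refine isOpen_ne.mem_nhds fun h => hx i (Finset.mem_Ioo.1 hi).1 (hf.injective h.symm)
    obtain ⟨δ, hδ, hball⟩ := Metric.mem_nhds_iff.1 hev
    obtain ⟨p, hp1, hp2⟩ := exists_rat_btwn (sub_lt_self (f x) hδ)
    obtain ⟨q, hq1, hq2⟩ := exists_rat_btwn (lt_add_of_pos_right (f x) hδ)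
    obtain ⟨k, hk⟩ := hI (p, q)
    refine ⟨k, ?_, fun i hi => ?_⟩
    · rw [hk]
      exact ⟨hp2, hq1⟩
    · rw [hk]
      intro hm
      refine hball (a := f (T^[i] x)) ?_ i hi rfl
      rw [Real.ball_eq_Ioo]
      exact ⟨hp1.trans hm.1, hm.2.trans hq2⟩
  have hex : ∀ x, ∃ k, x ∈ U k ∨ x ∉ ⋃ j, U j := fun x => by
    by_cases h : x ∈ ⋃ j, U j
    · obtain ⟨k, hk⟩ := mem_iUnion.1 h
      exact ⟨k, Or.inl hk⟩
    · exact ⟨0, Or.inr h⟩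
  refine ⟨fun x => Nat.find (hex x), measurable_find hex fun k =>
    (hU k).union (MeasurableSet.iUnion hU).compl, fun x hx i h0 hN heq => ?_⟩
  have hspec : ∀ m, T^[m] x ∈ U (Nat.find (hex (T^[m] x))) := fun m => by
    refine (Nat.find_spec (hex (T^[m] x))).resolve_right fun h => h ?_
    exact mem_iUnion.2 (hcov _ fun n hn => hx n hn m)
  have h1 := hspec 0
  simp only [Function.iterate_zero, id_eq] at h1
  have h2 : T^[i] x ∈ U (Nat.find (hex x)) := by
    have heq : Nat.find (hex x) = Nat.find (hex (T^[i] x)) := heq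
    rw [heq]
    exact hspec i
  exact h1.2 i (Finset.mem_Ioo.2 ⟨h0, hN⟩) h2.1

/-- A marker set: its first `N` translates are disjoint and almost every backward orbit meets
it. -/
theorem exists_marker_set {Ω : Type*} [MeasurableSpace Ω] [StandardBorelSpace Ω]
    {μ : Measure Ω} [IsProbabilityMeasure μ] {T S : Ω → Ω} (hT : MeasurePreserving T μ μ)
    (hS : MeasurePreserving S μ μ) (hST : Function.LeftInverse S T)
    (hTS : Function.LeftInverse T S) (haper : μ {x | ∃ n ≥ 1, T^[n] x = x} = 0) (N : ℕ) :
    ∃ F : Set Ω, MeasurableSet F ∧ (∀ x ∈ F, ∀ i, 0 < i → i < N → T^[i] x ∉ F) ∧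
      ∀ᵐ x ∂μ, ∃ n, S^[n] x ∈ F := by
  obtain ⟨c, hc, hcol⟩ := exists_measurable_orbit_coloring hT.measurable N
  have hinj : Function.Injective T := hST.injective
  have hX : ∀ x, (∀ n ≥ 1, T^[n] x ≠ x) → ∀ n ≥ 1, ∀ m, T^[n] (T^[m] x) ≠ T^[m] x := by
    intro x hx n hn m h
    rw [← Function.iterate_add_apply, add_comm, Function.iterate_add_apply] at h
    exact hx n hn (hinj.iterate m h)
  have hXS : ∀ x, (∀ n ≥ 1, T^[n] x ≠ x) → ∀ i, ∀ n ≥ 1, T^[n] (S^[i] x) ≠ S^[i] x := by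
    intro x hx i n hn h
    apply hx n hn
    have := congrArg T^[i] h
    rwa [← Function.iterate_add_apply, add_comm, Function.iterate_add_apply, hTS.iterate i] at this
  let F : Set Ω := {x | ∀ i ∈ Finset.Ioo 0 N, c x < c (T^[i] x) ∧ c x < c (S^[i] x)}
  have hFm : MeasurableSet F :=
    measurableSet_forall_mem_finset _ fun i =>
      (measurableSet_lt hc (hc.comp (hT.measurable.iterate i))).inter
        (measurableSet_lt hc (hc.comp (hS.measurable.iterate i)))
  refine ⟨F, hFm, fun x hx i h0 hN hTx => ?_, ?_⟩
  · have h1 := (hx i (Finset.mem_Ioo.2 ⟨h0, hN⟩)).1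
    have h2 := (hTx i (Finset.mem_Ioo.2 ⟨h0, hN⟩)).2
    rw [hST.iterate i] at h2
    exact lt_asymm h1 h2
  have hsweep : ∀ m, ∀ x, (∀ n ≥ 1, T^[n] x ≠ x) → c x = m →
      ∃ y ∈ F, ∃ n k, T^[n] x = T^[k] y := by
    intro m
    induction m using Nat.strong_induction_on with
    | _ m ih =>
      intro x hx hm
      by_cases hF : x ∈ F
      · exact ⟨x, hF, 0, 0, rfl⟩
      simp only [F, mem_ofPred_eq, not_forall, not_and_or, not_lt] at hF
      obtain ⟨i, hi, hle⟩ := hF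
      obtain ⟨h0, hN⟩ := Finset.mem_Ioo.1 hi
      rcases hle with hle | hle
      · have hne := hcol x (hX x hx) i h0 hN
        obtain ⟨y, hy, n, k, h⟩ := ih (c (T^[i] x)) (by omega) (T^[i] x)
          (fun n hn => hX x hx n hn i) rfl
        exact ⟨y, hy, n + i, k, by rw [Function.iterate_add_apply, h]⟩
      · have hne := hcol (S^[i] x) (hX _ (hXS x hx i)) i h0 hN
        rw [hTS.iterate i] at hne
        obtain ⟨y, hy, n, k, h⟩ := ih (c (S^[i] x)) (by omega) (S^[i] x) (hXS x hx i) rfl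
        refine ⟨y, hy, n, i + k, ?_⟩
        have h3 := congrArg T^[i] h
        rwa [← Function.iterate_add_apply, add_comm, Function.iterate_add_apply,
          hTS.iterate i, ← Function.iterate_add_apply] at h3
  let W : Set Ω := ⋃ n, S^[n] ⁻¹' F
  have hWm : MeasurableSet W := MeasurableSet.iUnion fun n => hS.measurable.iterate n hFm
  have hmono : ∀ n, W ⊆ T^[n] ⁻¹' W := by
    intro n x hx
    obtain ⟨k, hk⟩ := mem_iUnion.1 hx
    refine mem_iUnion.2 ⟨k + n, ?_⟩
    rw [mem_preimage, Function.iterate_add_apply, hST.iterate n]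
    exact hk
  have hnull : ∀ n, μ (T^[n] ⁻¹' W \ W) = 0 := fun n => by
    rw [measure_sdiff (hmono n) hWm.nullMeasurableSet (measure_ne_top _ _),
      (hT.iterate n).measure_preimage hWm.nullMeasurableSet, tsub_self]
  have h1 : ∀ᵐ x ∂μ, ∀ n, x ∉ T^[n] ⁻¹' W \ W :=
    ae_all_iff.2 fun n => measure_eq_zero_iff_ae_notMem.1 (hnull n)
  filter_upwards [h1, measure_eq_zero_iff_ae_notMem.1 haper] with x hx hap
  have hap' : ∀ n ≥ 1, T^[n] x ≠ x := fun n hn h => hap ⟨n, hn, h⟩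
  obtain ⟨y, hy, n, k, h⟩ := hsweep _ x hap' rfl
  have hxW : x ∈ W := by
    by_contra hxW
    refine hx n ⟨?_, hxW⟩
    rw [mem_preimage, h]
    exact mem_iUnion.2 ⟨k, by rw [mem_preimage, hST.iterate k]; exact hy⟩
  exact mem_iUnion.1 hxW

/-- **Rokhlin's lemma** for an aperiodic invertible transformation. -/
theorem exists_rokhlin_tower {Ω : Type*} [MeasurableSpace Ω] [StandardBorelSpace Ω]
    {μ : Measure Ω} [IsProbabilityMeasure μ] {T S : Ω → Ω} (hT : MeasurePreserving T μ μ)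
    (hS : MeasurePreserving S μ μ) (hST : Function.LeftInverse S T)
    (hTS : Function.LeftInverse T S) (haper : μ {x | ∃ n ≥ 1, T^[n] x = x} = 0)
    {H : ℕ} (hH : 0 < H) {r : ℝ} (hr : 0 < r) :
    ∃ E : Set Ω, MeasurableSet E ∧ (∀ x ∈ E, ∀ i, 0 < i → i < H → T^[i] x ∉ E) ∧
      μ.real {z | ∀ j < H, S^[j] z ∉ E} ≤ r := by
  obtain ⟨N, hN⟩ := exists_nat_gt (H / r)
  have hN0 : (0 : ℝ) < N := lt_of_le_of_lt (by positivity) hN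
  obtain ⟨F, hFm, hF, hsw⟩ := exists_marker_set hT hS hST hTS haper N
  let L : ℕ → Set Ω := fun j => {x | S^[j] x ∈ F ∧ ∀ i ∈ Finset.range j, S^[i] x ∉ F}
  have hLm : ∀ j, MeasurableSet (L j) := fun j => by
    refine (hS.measurable.iterate j hFm).inter ?_
    exact measurableSet_forall_mem_finset _ fun i => (hS.measurable.iterate i hFm).compl
  have hLdown : ∀ a b x, x ∈ L (a + b) → S^[b] x ∈ L a := by
    intro a b x hx
    refine ⟨?_, fun i hi => ?_⟩
    · rw [← Function.iterate_add_apply]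
      exact hx.1
    · rw [← Function.iterate_add_apply]
      exact hx.2 _ (by have := Finset.mem_range.1 hi; exact Finset.mem_range.2 (by omega))
  have hLuniq : ∀ a b x, x ∈ L a → x ∈ L b → a = b := by
    intro a b x ha hb
    rcases lt_trichotomy a b with h | h | h
    · exact absurd ha.1 (hb.2 a (Finset.mem_range.2 h))
    · exact h
    · exact absurd hb.1 (ha.2 b (Finset.mem_range.2 h))
  let E : Set Ω := ⋃ k, T^[H - 1] ⁻¹' L (k * H + (H - 1))
  have hlev : ∀ x ∈ E, ∃ k, ∀ j < H, T^[j] x ∈ L (k * H + j) := by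
    intro x hx
    obtain ⟨k, hk⟩ := mem_iUnion.1 hx
    refine ⟨k, fun j hj => ?_⟩
    have h1 : k * H + (H - 1) = (k * H + j) + (H - 1 - j) := by omega
    rw [mem_preimage, h1] at hk
    have h2 := hLdown _ _ _ hk
    have h3 := iterate_leftInverse_add hST (H - 1 - j) j x
    rw [show H - 1 - j + j = H - 1 by omega] at h3
    rwa [h3] at h2
  refine ⟨E, MeasurableSet.iUnion fun k => hT.measurable.iterate _ (hLm _), ?_, ?_⟩
  · intro x hx i h0 hi hTx
    obtain ⟨k, hk⟩ := hlev x hx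
    obtain ⟨k', hk'⟩ := hlev _ hTx
    have h1 := hLuniq _ _ _ (hk i hi) (hk' 0 hH)
    have h2 : (k * H + i) % H = (k' * H + 0) % H := by rw [h1]
    rw [Nat.mul_add_mod_self_right, Nat.mul_add_mod_self_right, Nat.mod_eq_of_lt hi,
      Nat.zero_mod] at h2
    omega
  have hsub : {z | ∀ j < H, S^[j] z ∉ E} ⊆
      {z | ¬ ∃ n, S^[n] z ∈ F} ∪ ⋃ s ∈ Finset.range H, T^[s] ⁻¹' F := by
    intro z hz
    by_contra hcon
    simp only [mem_union, not_or, mem_ofPred_eq, mem_iUnion, not_exists] at hcon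
    obtain ⟨hex, hno⟩ := hcon
    have hex : ∃ n, S^[n] z ∈ F := by
      by_contra! h
      exact hex h
    classical
    have ha : z ∈ L (Nat.find hex) :=
      ⟨Nat.find_spec hex, fun i hi => Nat.find_min hex (Finset.mem_range.1 hi)⟩
    obtain ⟨a, ha⟩ : ∃ a, z ∈ L a := ⟨_, ha⟩
    have hup : ∀ s < H, T^[s] z ∈ L (a + s) := by
      intro s hs
      refine ⟨?_, fun i hi => ?_⟩
      · rw [Function.iterate_add_apply, hST.iterate s]
        exact ha.1
      · have hi := Finset.mem_range.1 hi
        rcases Nat.lt_or_ge s i with h | h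
        · obtain ⟨d, rfl⟩ := Nat.exists_eq_add_of_lt h
          rw [show s + d + 1 = (d + 1) + s by omega, Function.iterate_add_apply, hST.iterate s]
          exact ha.2 _ (Finset.mem_range.2 (by omega))
        · obtain ⟨d, rfl⟩ := Nat.exists_eq_add_of_le h
          rw [iterate_leftInverse_add hST]
          exact hno d (Finset.mem_range.2 (by omega))
    have hi : a % H < H := Nat.mod_lt _ hH
    refine hz (a % H) hi (mem_iUnion.2 ⟨a / H, ?_⟩)
    have h1 := hup (H - 1 - a % H) (by omega)
    have h2 : a + (H - 1 - a % H) = a / H * H + (H - 1) := by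
      have := Nat.div_add_mod' a H
      omega
    have h3 : T^[H - 1] (S^[a % H] z) = T^[H - 1 - a % H] z := by
      have : H - 1 = (H - 1 - a % H) + a % H := by omega
      conv_lhs => rw [this]
      rw [Function.iterate_add_apply, hTS.iterate]
    rw [mem_preimage, h3, ← h2]
    exact h1
  have hbase := mul_measure_base_le_one hS hTS hFm hF
  have hFle : H * μ.real F ≤ r := by
    have h1 : μ.real F ≤ 1 / N := by
      rw [le_div_iff₀ hN0]
      linarith
    have h2 : (H : ℝ) < N * r := (div_lt_iff₀ hr).1 hN
    calc H * μ.real F ≤ (N * r) * (1 / N) := by gcongr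
      _ = r := by field_simp
  refine (measureReal_mono hsub).trans ((measureReal_union_le _ _).trans ?_)
  have h0 : μ.real {z | ¬ ∃ n, S^[n] z ∈ F} = 0 := by
    rw [measureReal_def, ae_iff.1 hsw, ENNReal.toReal_zero]
  rw [h0, zero_add]
  refine (measureReal_biUnion_finset_le _ _).trans (le_trans (le_of_eq ?_) hFle)
  rw [Finset.sum_congr rfl fun s _ => show μ.real (T^[s] ⁻¹' F) = μ.real F by
    rw [measureReal_def, (hT.iterate s).measure_preimage hFm.nullMeasurableSet, measureReal_def]]
  simp

theorem sum_range_mul_eq (f : ℕ → ℝ) (m P : ℕ) :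
    ∑ j ∈ Finset.range (m * P), f j
      = ∑ i ∈ Finset.range m, ∑ o ∈ Finset.range P, f (i * P + o) := by
  induction m with
  | zero => simp
  | succ m ih => rw [Nat.succ_mul, Finset.sum_range_add, ih, Finset.sum_range_succ]

theorem exists_subset_block (w : Finset ℕ) (a : ℕ) {k ℓ : ℕ} (hk : k ≤ ℓ) :
    ∃ d : Finset ℕ, ∑ i ∈ Finset.Ico a (a + ℓ), (if i ∈ d then (1 : ℝ) else 0) = k ∧
      ∑ i ∈ Finset.Ico a (a + ℓ), |(if i ∈ w then (1 : ℝ) else 0) - if i ∈ d then 1 else 0|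
        = |∑ i ∈ Finset.Ico a (a + ℓ), (if i ∈ w then (1 : ℝ) else 0) - k| := by
  set I := Finset.Ico a (a + ℓ) with hI
  have hsum : ∀ s : Finset ℕ, ∑ i ∈ I, (if i ∈ s then (1 : ℝ) else 0) = (I ∩ s).card := fun s => by
    rw [Finset.sum_ite_mem]
    simp
  have hcard : I.card = ℓ := by simp [hI]
  rcases le_total k (I ∩ w).card with h | h
  · obtain ⟨d, hd, hdk⟩ := Finset.exists_subset_card_eq h
    have hdI : I ∩ d = d := Finset.inter_eq_right.2 (hd.trans Finset.inter_subset_left)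
    refine ⟨d, by rw [hsum, hdI, hdk], ?_⟩
    have hnn : ∀ i, i ∈ d → i ∈ w := fun i hi => (Finset.mem_inter.1 (hd hi)).2
    rw [Finset.sum_congr rfl fun i _ => abs_of_nonneg
      (show (0 : ℝ) ≤ (if i ∈ w then (1 : ℝ) else 0) - if i ∈ d then 1 else 0 by
        have := hnn i
        split_ifs <;> simp_all),
      Finset.sum_sub_distrib, hsum, hsum, hdI, hdk, abs_of_nonneg]
    rw [sub_nonneg]
    exact_mod_cast h
  · obtain ⟨d, hwd, hd, hdk⟩ := Finset.exists_subsuperset_card_eq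
      (Finset.inter_subset_left (s₁ := I) (s₂ := w)) h (by rw [hcard]; exact hk)
    have hdI : I ∩ d = d := Finset.inter_eq_right.2 hd
    refine ⟨d, by rw [hsum, hdI, hdk], ?_⟩
    rw [Finset.sum_congr rfl fun i hi => abs_of_nonpos
      (show (if i ∈ w then (1 : ℝ) else 0) - (if i ∈ d then 1 else 0) ≤ 0 by
        have : i ∈ w → i ∈ d := fun h => hwd (Finset.mem_inter.2 ⟨hi, h⟩)
        split_ifs <;> simp_all),
      Finset.sum_neg_distrib, Finset.sum_sub_distrib, hsum, hsum, hdI, hdk, abs_of_nonpos]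
    rw [sub_nonpos]
    exact_mod_cast h

/-- A word can be rebalanced block by block so that its counting function stays close to a
prescribed profile `t`, at the cost of the discrepancy of the original word on the blocks. -/
theorem exists_balanced_word {t : ℕ → ℝ} (ht0 : t 0 = 0) (hmono : ∀ j, t j ≤ t (j + 1))
    (hlip : ∀ j, t (j + 1) ≤ t j + 1) (ℓ Q : ℕ) (w : Finset ℕ) :
    ∃ b : Finset ℕ,
      (∀ j ≤ Q * ℓ, |∑ i ∈ Finset.range j, (if i ∈ b then (1 : ℝ) else 0) - t j| ≤ ℓ + 1) ∧
      ∑ i ∈ Finset.range (Q * ℓ), |(if i ∈ w then (1 : ℝ) else 0) - if i ∈ b then 1 else 0|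
        ≤ ∑ p ∈ Finset.range Q, (|∑ i ∈ Finset.range ℓ, (if p * ℓ + i ∈ w then (1 : ℝ) else 0)
            - (t (p * ℓ + ℓ) - t (p * ℓ))| + 1) := by
  have hmono' : Monotone t := monotone_nat_of_le_succ hmono
  have hlip' : ∀ j d, t (j + d) ≤ t j + d := fun j d => by
    induction d with
    | zero => simp
    | succ d ih =>
      have := hlip (j + d)
      push_cast
      rw [← add_assoc]
      linarith
  have hnn : ∀ j, 0 ≤ t j := fun j => ht0 ▸ hmono' (Nat.zero_le j)
  suffices h : ∃ b : Finset ℕ,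
      ∑ i ∈ Finset.range (Q * ℓ), (if i ∈ b then (1 : ℝ) else 0) = ⌊t (Q * ℓ)⌋₊ ∧
      (∀ j ≤ Q * ℓ, |∑ i ∈ Finset.range j, (if i ∈ b then (1 : ℝ) else 0) - t j| ≤ ℓ + 1) ∧
      ∑ i ∈ Finset.range (Q * ℓ), |(if i ∈ w then (1 : ℝ) else 0) - if i ∈ b then 1 else 0|
        ≤ ∑ p ∈ Finset.range Q, (|∑ i ∈ Finset.range ℓ, (if p * ℓ + i ∈ w then (1 : ℝ) else 0)
            - (t (p * ℓ + ℓ) - t (p * ℓ))| + 1) by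
    obtain ⟨b, -, h⟩ := h
    exact ⟨b, h⟩
  induction Q with
  | zero => 
    refine ⟨∅, by simp [ht0], fun j hj => ?_, by simp⟩
    obtain rfl : j = 0 := by simpa using hj
    simp [ht0]
    positivity
  | succ Q ih =>
    obtain ⟨b, hb1, hb2, hb3⟩ := ih
    set A := Q * ℓ with hA
    have hA' : (Q + 1) * ℓ = A + ℓ := by rw [hA]; ring
    have hk1 : ⌊t A⌋₊ ≤ ⌊t (A + ℓ)⌋₊ := Nat.floor_mono (hmono' (Nat.le_add_right _ _))
    have hk2 : ⌊t (A + ℓ)⌋₊ ≤ ⌊t A⌋₊ + ℓ := by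
      rw [← Nat.floor_add_natCast (hnn A)]
      exact Nat.floor_mono (hlip' A ℓ)
    obtain ⟨d, hd1, hd2⟩ := exists_subset_block w A
      (show ⌊t (A + ℓ)⌋₊ - ⌊t A⌋₊ ≤ ℓ by omega)
    rw [Nat.cast_sub hk1] at hd1 hd2
    let b' : Finset ℕ := b.filter (· < A) ∪ d.filter (A ≤ ·)
    have hlow : ∀ i, i < A → (i ∈ b' ↔ i ∈ b) := fun i hi => by
      simp [b', hi]
    have hhigh : ∀ i, A ≤ i → (i ∈ b' ↔ i ∈ d) := fun i hi => by
      simp [b', hi, not_lt.2 hi]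
    have hsumlow : ∀ j ≤ A, ∑ i ∈ Finset.range j, (if i ∈ b' then (1 : ℝ) else 0)
        = ∑ i ∈ Finset.range j, (if i ∈ b then (1 : ℝ) else 0) := fun j hj =>
      Finset.sum_congr rfl fun i hi => by
        simp only [hlow i (lt_of_lt_of_le (Finset.mem_range.1 hi) hj)]
    have hsumhigh : ∀ e, ∑ i ∈ Finset.Ico A (A + e), (if i ∈ b' then (1 : ℝ) else 0)
        = ∑ i ∈ Finset.Ico A (A + e), (if i ∈ d then (1 : ℝ) else 0) := fun e =>
      Finset.sum_congr rfl fun i hi => by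
        simp only [hhigh i (Finset.mem_Ico.1 hi).1]
    have hsplit : ∀ (f : ℕ → ℝ) e, ∑ i ∈ Finset.range (A + e), f i
        = ∑ i ∈ Finset.range A, f i + ∑ i ∈ Finset.Ico A (A + e), f i := fun f e =>
      (Finset.sum_range_add_sum_Ico f (Nat.le_add_right A e)).symm
    have hf1 := Nat.floor_le (hnn A)
    have hf2 := Nat.lt_floor_add_one (t A)
    have hf3 := Nat.floor_le (hnn (A + ℓ))
    have hf4 := Nat.lt_floor_add_one (t (A + ℓ))
    refine ⟨b', ?_, ?_, ?_⟩
    · rw [hA', hsplit, hsumlow A le_rfl, hsumhigh, hb1, hd1]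
      ring
    · intro j hj
      rw [hA'] at hj
      rcases le_total j A with h | h
      · rw [hsumlow j h]
        exact hb2 j h
      · obtain ⟨e, rfl⟩ := Nat.exists_eq_add_of_le h
        rw [hsplit, hsumlow A le_rfl, hsumhigh, hb1]
        have h0 : 0 ≤ ∑ i ∈ Finset.Ico A (A + e), (if i ∈ d then (1 : ℝ) else 0) :=
          Finset.sum_nonneg fun i _ => by split_ifs <;> norm_num
        have h1 : ∑ i ∈ Finset.Ico A (A + e), (if i ∈ d then (1 : ℝ) else 0) ≤ e := by
          calc _ ≤ ∑ i ∈ Finset.Ico A (A + e), (1 : ℝ) :=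
                Finset.sum_le_sum fun i _ => by split_ifs <;> norm_num
            _ = e := by simp
        have h2 := hlip' A e
        have h3 : t A ≤ t (A + e) := hmono' h
        have h4 : (e : ℝ) ≤ ℓ := by exact_mod_cast (by omega : e ≤ ℓ)
        rw [abs_le]
        constructor <;> linarith
    · rw [hA', hsplit, Finset.sum_range_succ]
      refine add_le_add ?_ ?_
      · refine le_trans (le_of_eq (Finset.sum_congr rfl fun i hi => ?_)) hb3
        simp only [hlow i (Finset.mem_range.1 hi)]
      · rw [Finset.sum_congr rfl fun i hi => by
          simp only [hhigh i (Finset.mem_Ico.1 hi).1]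
          rfl, hd2, Finset.sum_Ico_eq_sum_range, Nat.add_sub_cancel_left, ← hA]
        rw [abs_le]
        have h5 := le_abs_self (∑ i ∈ Finset.range ℓ, (if A + i ∈ w then (1 : ℝ) else 0)
          - (t (A + ℓ) - t A))
        have h6 := neg_abs_le (∑ i ∈ Finset.range ℓ, (if A + i ∈ w then (1 : ℝ) else 0)
          - (t (A + ℓ) - t A))
        constructor <;> linarith

/-- The function equal to `v j x` at the point `T^[j] x` of level `j < H` over `x ∈ E`, and to `0`
off the tower; here `S` is the inverse of `T`. -/
noncomputable def towerLift {Ω : Type*} (S : Ω → Ω) (E : Set Ω) (H : ℕ) (v : ℕ → Ω → ℝ) (z : Ω) :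
    ℝ :=
  ∑ j ∈ Finset.range H, (S^[j] ⁻¹' E).indicator (fun z => v j (S^[j] z)) z

section Tower

variable {Ω : Type*} {T S : Ω → Ω} {E : Set Ω} {H : ℕ}

theorem mem_level_iff (hST : Function.LeftInverse S T)
    (hTS : Function.LeftInverse T S) (hE : ∀ x ∈ E, ∀ i, 0 < i → i < H → T^[i] x ∉ E)
    {x : Ω} (hx : x ∈ E) {i j : ℕ} (hi : i < H) (hj : j < H) : S^[i] (T^[j] x) ∈ E ↔ i = j := by
  refine ⟨fun h => ?_, fun h => by rw [h, hST.iterate]; exact hx⟩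
  by_contra hij
  have hd := pairwise_disjoint_levels hTS hE (by simpa using hi) (by simpa using hj) hij
  exact Set.disjoint_left.1 hd h (by rw [mem_preimage, hST.iterate]; exact hx)

theorem towerLift_apply (hST : Function.LeftInverse S T)
    (hTS : Function.LeftInverse T S) (hE : ∀ x ∈ E, ∀ i, 0 < i → i < H → T^[i] x ∉ E)
    (v : ℕ → Ω → ℝ) {x : Ω} (hx : x ∈ E) {j : ℕ} (hj : j < H) :
    towerLift S E H v (T^[j] x) = v j x := by
  classical
  rw [towerLift, Finset.sum_eq_single_of_mem j (Finset.mem_range.2 hj)]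
  · rw [indicator_of_mem (by rw [mem_preimage, hST.iterate]; exact hx), hST.iterate]
  · intro i hi hij
    refine indicator_of_notMem (fun h => hij ?_) _
    exact (mem_level_iff hST hTS hE hx (Finset.mem_range.1 hi) hj).1 h

theorem towerLift_of_forall_notMem (v : ℕ → Ω → ℝ) {z : Ω} (hz : ∀ j < H, S^[j] z ∉ E) :
    towerLift S E H v z = 0 :=
  Finset.sum_eq_zero fun j hj => indicator_of_notMem (hz j (Finset.mem_range.1 hj)) _

theorem exists_eq_iterate_or_forall_notMem (hTS : Function.LeftInverse T S) (E : Set Ω) (H : ℕ)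
    (z : Ω) : (∃ x ∈ E, ∃ j < H, z = T^[j] x) ∨ ∀ j < H, S^[j] z ∉ E := by
  by_cases h : ∀ j < H, S^[j] z ∉ E
  · exact Or.inr h
  · push Not at h
    obtain ⟨j, hj, hz⟩ := h
    exact Or.inl ⟨_, hz, j, hj, (hTS.iterate j z).symm⟩

theorem exists_eq_or_forall_notMem_of_iterate_succ (hST : Function.LeftInverse S T)
    (hTS : Function.LeftInverse T S) (hE : ∀ x ∈ E, ∀ i, 0 < i → i < H → T^[i] x ∉ E) {z : Ω}
    (hz : (∀ j < H, S^[j] z ∉ E) ∨ ∃ x ∈ E, z = T^[H - 1] x) :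
    T z ∈ E ∨ ∀ j < H, S^[j] (T z) ∉ E := by
  by_contra! h
  obtain ⟨h0, j, hj, hjE⟩ := h
  cases j with
  | zero => exact h0 hjE
  | succ j =>
    rw [Function.iterate_succ_apply, hST] at hjE
    rcases hz with hz | ⟨x, hx, rfl⟩
    · exact hz j (by omega) hjE
    · have := (mem_level_iff hST hTS hE hx (by omega) (by omega)).1 hjE
      omega

theorem measurable_towerLift [MeasurableSpace Ω] (hS : Measurable S) (hEm : MeasurableSet E)
    {v : ℕ → Ω → ℝ} (hv : ∀ j, Measurable (v j)) : Measurable (towerLift S E H v) :=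
  Finset.measurable_sum _ fun j _ =>
    ((hv j).comp (hS.iterate j)).indicator (hS.iterate j hEm)

theorem integral_eq_setIntegral_tower [MeasurableSpace Ω] [StandardBorelSpace Ω] {μ : Measure Ω}
    (hT : MeasurePreserving T μ μ) (hS : Measurable S) (hST : Function.LeftInverse S T)
    (hTS : Function.LeftInverse T S) (hEm : MeasurableSet E)
    (hE : ∀ x ∈ E, ∀ i, 0 < i → i < H → T^[i] x ∉ E) {f : Ω → ℝ} (hf : Integrable f μ) :
    ∫ z, f z ∂μ = ∫ x in E, ∑ j ∈ Finset.range H, f (T^[j] x) ∂μ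
      + ∫ z in {z | ∀ j < H, S^[j] z ∉ E}, f z ∂μ := by
  have hm : MeasurableSet (⋃ j ∈ Finset.range H, S^[j] ⁻¹' E) :=
    (Finset.range H).measurableSet_biUnion fun j _ => hS.iterate j hEm
  rw [← integral_add_compl hm hf]
  congr 1
  · rw [integral_biUnion_finset _ (fun j _ => hS.iterate j hEm) (pairwise_disjoint_levels hTS hE)
      fun j _ => hf.integrableOn, integral_finsetSum]
    · refine Finset.sum_congr rfl fun j _ => ?_
      have hemb : MeasurableEmbedding T^[j] :=
        (hT.measurable.iterate j).measurableEmbedding (hST.injective.iterate j)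
      have := (hT.iterate j).setIntegral_preimage_emb hemb f (S^[j] ⁻¹' E)
      rw [← this, ← preimage_comp, (hST.iterate j).comp_eq_id, preimage_id]
    · intro j _
      exact ((hT.iterate j).integrable_comp_of_integrable hf).integrableOn
  · congr 2
    ext z
    simp

end Tower

/-- Up to an `L¹` error `η`, the function `1_A - c` is the coboundary of a bounded measurable
function. -/
def IsNearCoboundary {Ω : Type*} [MeasurableSpace Ω] (μ : Measure Ω) (T : Ω → Ω) (A : Set Ω)
    (c η : ℝ) : Prop :=
  ∃ g : Ω → ℝ, Measurable g ∧ (∃ K, ∀ x, |g x| ≤ K) ∧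
    ∫ x, |A.indicator (fun _ => (1 : ℝ)) x - c - (g (T x) - g x)| ∂μ ≤ η

theorem abs_indicator_one_sub_le {Ω : Type*} (B : Set Ω) {c : ℝ} (hc0 : 0 ≤ c) (hc1 : c ≤ 1) (z : Ω) :
    |B.indicator (fun _ => (1 : ℝ)) z - c| ≤ 1 := by
  by_cases h : z ∈ B
  · rw [indicator_of_mem h, abs_le]
    constructor <;> linarith
  · rw [indicator_of_notMem h, abs_le]
    constructor <;> linarith

theorem measurableSet_forall_iterate_notMem {Ω : Type*} [MeasurableSpace Ω] {S : Ω → Ω}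
    {E : Set Ω} {H : ℕ} (hS : Measurable S) (hEm : MeasurableSet E) :
    MeasurableSet {z | ∀ j < H, S^[j] z ∉ E} := by
  have := measurableSet_forall_mem_finset (Finset.range H) fun i => (hS.iterate i hEm).compl
  simpa using this

theorem integrable_of_measurable_of_bound {Ω : Type*} [MeasurableSpace Ω] {μ : Measure Ω}
    [IsFiniteMeasure μ] {f : Ω → ℝ} (hf : Measurable f) {C : ℝ}
    (h : ∀ x, |f x| ≤ C) : Integrable f μ :=
  Integrable.of_bound hf.aestronglyMeasurable C (.of_forall h)

theorem abs_sum_indicator_sub_le {Ω : Type*} {T : Ω → Ω} {A : Set Ω} {c K : ℝ} {g : Ω → ℝ} (hK : ∀ x, |g x| ≤ K) (m : ℕ)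
    (y : Ω) :
    |∑ i ∈ Finset.range m, A.indicator (fun _ => (1 : ℝ)) (T^[i] y) - c * m| ≤ 2 * K +
      ∑ i ∈ Finset.range m,
        |A.indicator (fun _ => (1 : ℝ)) (T^[i] y) - c - (g (T (T^[i] y)) - g (T^[i] y))| := by
  have h1 : ∑ i ∈ Finset.range m, A.indicator (fun _ => (1 : ℝ)) (T^[i] y) - c * m
      = (g (T^[m] y) - g y) + ∑ i ∈ Finset.range m,
        (A.indicator (fun _ => (1 : ℝ)) (T^[i] y) - c - (g (T (T^[i] y)) - g (T^[i] y))) := by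
    have h2 := Finset.sum_range_sub (fun i => g (T^[i] y)) m
    simp only [Function.iterate_succ_apply', Function.iterate_zero, id_eq] at h2
    rw [Finset.sum_sub_distrib, h2, Finset.sum_sub_distrib]
    simp
    ring
  rw [h1]
  refine (abs_add_le _ _).trans (add_le_add ?_ (Finset.abs_sum_le_sum_abs _ _))
  refine (abs_sub _ _).trans ?_
  linarith [hK (T^[m] y), hK y]

section Modification

variable {Ω : Type*} [MeasurableSpace Ω] {T S : Ω → Ω} {E : Set Ω} {H : ℕ}

theorem exists_tower_modification (hT : Measurable T) (hS : Measurable S)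
    (hST : Function.LeftInverse S T)
    (hTS : Function.LeftInverse T S) (hEm : MeasurableSet E) {Q ℓ : ℕ}
    (hE : ∀ x ∈ E, ∀ i, 0 < i → i < Q * ℓ → T^[i] x ∉ E) {A : Set Ω} (hA : MeasurableSet A)
    {t : ℕ → ℝ} (ht0 : t 0 = 0) (hmono : ∀ j, t j ≤ t (j + 1))
    (hlip : ∀ j, t (j + 1) ≤ t j + 1) :
    ∃ B, MeasurableSet B ∧ (∀ x ∈ E, ∀ j ≤ Q * ℓ,
        |∑ i ∈ Finset.range j, B.indicator (fun _ => (1 : ℝ)) (T^[i] x) - t j| ≤ ℓ + 1) ∧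
      ∀ x ∈ E, ∑ j ∈ Finset.range (Q * ℓ), |A.indicator (fun _ => (1 : ℝ)) (T^[j] x)
          - B.indicator (fun _ => (1 : ℝ)) (T^[j] x)|
        ≤ ∑ p ∈ Finset.range Q,
          (|∑ i ∈ Finset.range ℓ, A.indicator (fun _ => (1 : ℝ)) (T^[p * ℓ + i] x)
            - (t (p * ℓ + ℓ) - t (p * ℓ))| + 1) := by
  classical
  choose Φ hΦ1 hΦ2 using exists_balanced_word ht0 hmono hlip ℓ Q
  let W : Ω → Finset ℕ := fun x => (Finset.range (Q * ℓ)).filter fun i => T^[i] x ∈ A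
  have hWm : ∀ w, MeasurableSet {x | W x = w} := by
    intro w
    have : {x | W x = w} = {x | ∀ i ∈ Finset.range (Q * ℓ), (T^[i] x ∈ A ↔ i ∈ w)} ∩
        {x | w ⊆ Finset.range (Q * ℓ)} := by
      ext x
      simp only [W, mem_inter_iff, mem_ofPred_eq, Finset.ext_iff, Finset.mem_filter,
        Finset.subset_iff]
      constructor
      · intro h
        exact ⟨fun i hi => by simp [← h, hi], fun i hi => ((h i).2 hi).1⟩
      · rintro ⟨h1, h2⟩ i
        exact ⟨fun h => (h1 i h.1).1 h.2, fun h => ⟨h2 h, (h1 i (h2 h)).2 h⟩⟩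
    rw [this]
    refine (measurableSet_forall_mem_finset _ fun i => ?_).inter (.const _)
    by_cases hi : i ∈ w
    · simp only [hi, iff_true]
      exact hT.iterate i hA
    · simp only [hi, iff_false]
      exact (hT.iterate i hA).compl
  let v : ℕ → Ω → ℝ := fun j x => if j ∈ Φ (W x) then 1 else 0
  have hv : ∀ j, Measurable (v j) := by
    intro j
    refine Measurable.ite ?_ measurable_const measurable_const
    have : {x | j ∈ Φ (W x)} = ⋃ w ∈ {w | j ∈ Φ w}, {x | W x = w} := by
      ext x
      simp
    rw [this]
    exact MeasurableSet.biUnion (to_countable _) fun w _ => hWm w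
  have hlift := measurable_towerLift (H := Q * ℓ) hS hEm hv
  have hB : ∀ x ∈ E, ∀ j < Q * ℓ,
      (towerLift S E (Q * ℓ) v ⁻¹' {1}).indicator (fun _ => (1 : ℝ)) (T^[j] x)
        = if j ∈ Φ (W x) then 1 else 0 := by
    intro x hx j hj
    rw [Set.indicator_apply, mem_preimage, towerLift_apply hST hTS hE v hx hj]
    by_cases h : j ∈ Φ (W x) <;> simp [v, h]
  have hA' : ∀ x, ∀ j < Q * ℓ,
      A.indicator (fun _ => (1 : ℝ)) (T^[j] x) = if j ∈ W x then 1 else 0 := by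
    intro x j hj
    simp [W, Set.indicator_apply, hj]
  refine ⟨_, hlift (measurableSet_singleton 1), fun x hx j hj => ?_, fun x hx => ?_⟩
  · rw [Finset.sum_congr rfl fun i hi =>
      hB x hx i ((Finset.mem_range.1 hi).trans_le hj)]
    exact hΦ1 _ j hj
  · rw [Finset.sum_congr rfl fun i hi => by
      rw [hB x hx i (Finset.mem_range.1 hi), hA' x i (Finset.mem_range.1 hi)]]
    refine (hΦ2 (W x)).trans (le_of_eq (Finset.sum_congr rfl fun p hp => ?_))
    rw [Finset.sum_congr rfl fun i hi => (hA' x _ ?_).symm]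
    have h1 := Finset.mem_range.1 hp
    have h2 := Finset.mem_range.1 hi
    calc p * ℓ + i < (p + 1) * ℓ := by rw [add_mul, one_mul]; omega
      _ ≤ Q * ℓ := Nat.mul_le_mul_right _ h1

variable [StandardBorelSpace Ω] {μ : Measure Ω} [IsProbabilityMeasure μ]

theorem isNearCoboundary_of_tower (hT : MeasurePreserving T μ μ) (hS : Measurable S)
    (hST : Function.LeftInverse S T) (hTS : Function.LeftInverse T S) (hEm : MeasurableSet E)
    (hE : ∀ x ∈ E, ∀ i, 0 < i → i < H → T^[i] x ∉ E) {B : Set Ω} (hB : MeasurableSet B)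
    {c D : ℝ} (hc0 : 0 ≤ c) (hc1 : c ≤ 1) (hH : 0 < H)
    (hD : ∀ x ∈ E, |∑ i ∈ Finset.range H, B.indicator (fun _ => (1 : ℝ)) (T^[i] x) - c * H| ≤ D) :
    IsNearCoboundary μ T B c (D * μ.real E + μ.real {z | ∀ j < H, S^[j] z ∉ E}) := by
  let v : ℕ → Ω → ℝ := fun j x =>
    ∑ i ∈ Finset.range j, (B.indicator (fun _ => (1 : ℝ)) (T^[i] x) - c)
  have h1m : Measurable (B.indicator (fun _ => (1 : ℝ))) := measurable_const.indicator hB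
  have hv : ∀ j, Measurable (v j) := fun j => Finset.measurable_sum _ fun i _ =>
    (h1m.comp (hT.measurable.iterate i)).sub_const c
  have hvb : ∀ j ≤ H, ∀ x, |v j x| ≤ H := by
    intro j hj x
    refine (Finset.abs_sum_le_sum_abs _ _).trans ?_
    refine (Finset.sum_le_sum fun i _ => abs_indicator_one_sub_le B hc0 hc1 _).trans ?_
    simpa using hj
  set g := towerLift S E H v with hg
  have hgm : Measurable g := measurable_towerLift hS hEm hv
  have hgapp : ∀ x ∈ E, ∀ j < H, g (T^[j] x) = v j x := fun x hx j hj =>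
    towerLift_apply hST hTS hE v hx hj
  have hgoff : ∀ z, (∀ j < H, S^[j] z ∉ E) → g z = 0 := fun z hz =>
    towerLift_of_forall_notMem v hz
  have hgb : ∀ z, |g z| ≤ H := by
    intro z
    rcases exists_eq_iterate_or_forall_notMem hTS E H z with ⟨x, hx, j, hj, rfl⟩ | h
    · rw [hgapp x hx j hj]
      exact hvb j hj.le x
    · rw [hgoff z h]
      simp
  have hgnext : ∀ z, ((∀ j < H, S^[j] z ∉ E) ∨ ∃ x ∈ E, z = T^[H - 1] x) → g (T z) = 0 := by
    intro z hz
    rcases exists_eq_or_forall_notMem_of_iterate_succ hST hTS hE hz with h | h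
    · have := hgapp _ h 0 hH
      simpa [v] using this
    · exact hgoff _ h
  refine ⟨g, hgm, ⟨H, hgb⟩, ?_⟩
  set f : Ω → ℝ := fun z => |B.indicator (fun _ => (1 : ℝ)) z - c - (g (T z) - g z)| with hf
  have hfm : Measurable f :=
    ((h1m.sub_const c).sub ((hgm.comp hT.measurable).sub hgm)).abs
  have hfint : Integrable f μ := integrable_of_measurable_of_bound hfm (C := 1 + (H + H)) fun z => by
    rw [hf, abs_abs]
    exact (abs_sub _ _).trans (add_le_add (abs_indicator_one_sub_le B hc0 hc1 z)
      ((abs_sub _ _).trans (add_le_add (hgb _) (hgb _))))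
  rw [integral_eq_setIntegral_tower hT hS hST hTS hEm hE hfint]
  have hoffm := measurableSet_forall_iterate_notMem (H := H) hS hEm
  refine add_le_add ?_ ?_
  · have hsum : ∀ x ∈ E, ∑ j ∈ Finset.range H, f (T^[j] x) ≤ D := by
      intro x hx
      obtain ⟨H', rfl⟩ : ∃ H', H = H' + 1 := ⟨H - 1, by omega⟩
      rw [Finset.sum_range_succ, Finset.sum_eq_zero, zero_add]
      · have h1 : f (T^[H'] x) = |∑ i ∈ Finset.range (H' + 1),
            B.indicator (fun _ => (1 : ℝ)) (T^[i] x) - c * ↑(H' + 1)| := by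
          rw [hf]
          simp only
          rw [hgnext (T^[H'] x) (Or.inr ⟨x, hx, rfl⟩), hgapp x hx H' (by omega)]
          congr 1
          simp only [v, Finset.sum_sub_distrib, Finset.sum_range_succ, Finset.sum_const,
            Finset.card_range, nsmul_eq_mul]
          push_cast
          ring
        rw [h1]
        exact hD x hx
      · intro j hj
        have hj := Finset.mem_range.1 hj
        rw [hf]
        simp only
        rw [← Function.iterate_succ_apply' T, hgapp x hx j (by omega),
          hgapp x hx (j + 1) (by omega)]
        simp only [v, Finset.sum_range_succ]
        rw [add_sub_cancel_left, sub_self, abs_zero]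
    calc ∫ x in E, ∑ j ∈ Finset.range H, f (T^[j] x) ∂μ ≤ ∫ x in E, D ∂μ :=
          setIntegral_mono_on (integrable_finsetSum _ fun j _ =>
            ((hT.iterate j).integrable_comp_of_integrable hfint)).integrableOn
            (integrable_const _).integrableOn hEm hsum
      _ = D * μ.real E := by rw [setIntegral_const, smul_eq_mul, mul_comm]
  · calc ∫ z in {z | ∀ j < H, S^[j] z ∉ E}, f z ∂μ
          ≤ ∫ z in {z | ∀ j < H, S^[j] z ∉ E}, 1 ∂μ :=
          setIntegral_mono_on hfint.integrableOn (integrable_const _).integrableOn hoffm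
            fun z hz => by
              rw [hf]
              simp only
              rw [hgnext z (Or.inl hz), hgoff z hz, sub_zero, sub_zero]
              exact abs_indicator_one_sub_le B hc0 hc1 z
      _ = μ.real {z | ∀ j < H, S^[j] z ∉ E} := by rw [setIntegral_const, smul_eq_mul, mul_one]

theorem integral_abs_indicator_sub_le_of_tower (hT : MeasurePreserving T μ μ)
    (hS : MeasurePreserving S μ μ)
    (hST : Function.LeftInverse S T) (hTS : Function.LeftInverse T S) (hEm : MeasurableSet E)
    {Q ℓ : ℕ} (hℓ : 0 < ℓ)
    (hE : ∀ x ∈ E, ∀ i, 0 < i → i < Q * ℓ → T^[i] x ∉ E) {A B : Set Ω} (hA : MeasurableSet A)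
    (hB : MeasurableSet B) {c K ρ : ℝ} {g : Ω → ℝ} (hg : Measurable g)
    (hK : ∀ x, |g x| ≤ K) (hρ : 0 ≤ ρ) {t : ℕ → ℝ}
    (ht : ∀ p, |t (p * ℓ + ℓ) - t (p * ℓ) - c * ℓ| ≤ ρ * ℓ)
    (hcost : ∀ x ∈ E, ∑ j ∈ Finset.range (Q * ℓ), |A.indicator (fun _ => (1 : ℝ)) (T^[j] x)
          - B.indicator (fun _ => (1 : ℝ)) (T^[j] x)|
        ≤ ∑ p ∈ Finset.range Q,
          (|∑ i ∈ Finset.range ℓ, A.indicator (fun _ => (1 : ℝ)) (T^[p * ℓ + i] x)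
            - (t (p * ℓ + ℓ) - t (p * ℓ))| + 1)) :
    ∫ z, |A.indicator (fun _ => (1 : ℝ)) z - B.indicator (fun _ => (1 : ℝ)) z| ∂μ ≤
      (2 * K + 1) / ℓ + ρ + ∫ x, |A.indicator (fun _ => (1 : ℝ)) x - c - (g (T x) - g x)| ∂μ
        + μ.real {z | ∀ j < Q * ℓ, S^[j] z ∉ E} := by
  have hAm : Measurable (A.indicator (fun _ => (1 : ℝ))) := measurable_const.indicator hA
  have hBm : Measurable (B.indicator (fun _ => (1 : ℝ))) := measurable_const.indicator hB
  set d : Ω → ℝ := fun z => |A.indicator (fun _ => (1 : ℝ)) z - B.indicator (fun _ => (1 : ℝ)) z|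
    with hd
  have hd1 : ∀ z, |d z| ≤ 1 := fun z => by
    rw [hd]
    by_cases h1 : z ∈ A <;> by_cases h2 : z ∈ B <;> simp [h1, h2]
  have hdint : Integrable d μ := integrable_of_measurable_of_bound (hAm.sub hBm).abs hd1
  set f : Ω → ℝ := fun x => |A.indicator (fun _ => (1 : ℝ)) x - c - (g (T x) - g x)| with hf
  have hA1 : Integrable (A.indicator (fun _ => (1 : ℝ))) μ := (integrable_const _).indicator hA
  have hgint : Integrable g μ := integrable_of_measurable_of_bound hg hK
  have hfint : Integrable f μ := ((hA1.sub (integrable_const c)).sub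
    ((hT.integrable_comp_of_integrable hgint).sub hgint)).abs
  have hoffm := measurableSet_forall_iterate_notMem (H := Q * ℓ) hS.measurable hEm
  rw [integral_eq_setIntegral_tower hT hS.measurable hST hTS hEm hE hdint]
  refine add_le_add ?_ ?_
  · have hx : ∀ x ∈ E, ∑ j ∈ Finset.range (Q * ℓ), d (T^[j] x)
        ≤ Q * (2 * K + ρ * ℓ + 1) + ∑ j ∈ Finset.range (Q * ℓ), f (T^[j] x) := by
      intro x hx
      refine (hcost x hx).trans ?_
      have h0 : (Q : ℝ) * (2 * K + ρ * ℓ + 1) = ∑ _p ∈ Finset.range Q, (2 * K + ρ * ℓ + 1) := by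
        rw [Finset.sum_const, Finset.card_range, nsmul_eq_mul]
      rw [sum_range_mul_eq, h0, ← Finset.sum_add_distrib]
      refine Finset.sum_le_sum fun p _ => ?_
      have h1 := abs_sum_indicator_sub_le (T := T) (A := A) (c := c) hK ℓ (T^[p * ℓ] x)
      simp only [← Function.iterate_add_apply] at h1
      have h2 := abs_sub_le (∑ i ∈ Finset.range ℓ, A.indicator (fun _ => (1 : ℝ)) (T^[i + p * ℓ] x))
        (c * ℓ) (t (p * ℓ + ℓ) - t (p * ℓ))
      have h3 := ht p
      rw [abs_sub_comm] at h3
      simp only [hf]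
      simp only [add_comm (p * ℓ)] at h1 h2 h3 ⊢
      linarith
    have hfi : ∀ u : Ω → ℝ, Integrable u μ →
        IntegrableOn (fun x => ∑ j ∈ Finset.range (Q * ℓ), u (T^[j] x)) E μ := fun u hu =>
      (integrable_finsetSum _ fun j _ =>
        ((hT.iterate j).integrable_comp_of_integrable hu)).integrableOn
    have hfle : ∫ x in E, ∑ j ∈ Finset.range (Q * ℓ), f (T^[j] x) ∂μ ≤ ∫ x, f x ∂μ := by
      rw [integral_eq_setIntegral_tower hT hS.measurable hST hTS hEm hE hfint]
      exact le_add_of_nonneg_right (integral_nonneg fun z => abs_nonneg _)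
    have hbase : Q * μ.real E ≤ 1 / ℓ := by
      have := mul_measure_base_le_one hS hTS hEm hE
      push_cast at this
      rw [le_div_iff₀ (by exact_mod_cast hℓ)]
      linarith
    have hK0 : 0 ≤ K := by
      obtain ⟨x⟩ : Nonempty Ω := nonempty_of_isProbabilityMeasure μ
      exact (abs_nonneg _).trans (hK x)
    calc ∫ x in E, ∑ j ∈ Finset.range (Q * ℓ), d (T^[j] x) ∂μ
        ≤ ∫ x in E, (Q * (2 * K + ρ * ℓ + 1) + ∑ j ∈ Finset.range (Q * ℓ), f (T^[j] x)) ∂μ :=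
          setIntegral_mono_on (hfi d hdint)
            ((integrable_const _).integrableOn.add (hfi f hfint)) hEm hx
      _ = Q * μ.real E * (2 * K + ρ * ℓ + 1)
          + ∫ x in E, ∑ j ∈ Finset.range (Q * ℓ), f (T^[j] x) ∂μ := by
          rw [integral_add (integrable_const _).integrableOn (hfi f hfint), setIntegral_const,
            smul_eq_mul]
          ring
      _ ≤ 1 / ℓ * (2 * K + ρ * ℓ + 1) + ∫ x, f x ∂μ := by gcongr
      _ = (2 * K + 1) / ℓ + ρ + ∫ x, f x ∂μ := by
          have : (ℓ : ℝ) ≠ 0 := by positivity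
          field_simp
          ring
  · calc ∫ z in {z | ∀ j < Q * ℓ, S^[j] z ∉ E}, d z ∂μ
          ≤ ∫ z in {z | ∀ j < Q * ℓ, S^[j] z ∉ E}, 1 ∂μ :=
          setIntegral_mono_on hdint.integrableOn (integrable_const _).integrableOn hoffm
            fun z _ => (le_abs_self _).trans (hd1 z)
      _ = μ.real {z | ∀ j < Q * ℓ, S^[j] z ∉ E} := by
          rw [setIntegral_const, smul_eq_mul, mul_one]

end Modification

theorem sum_range_iterate_shift {Ω : Type*} {T : Ω → Ω} (u : Ω → ℝ) (j n : ℕ) (x : Ω) :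
    ∑ i ∈ Finset.range n, u (T^[i] (T^[j] x))
      = ∑ i ∈ Finset.range (j + n), u (T^[i] x) - ∑ i ∈ Finset.range j, u (T^[i] x) := by
  rw [Finset.sum_range_add, add_sub_cancel_left]
  refine Finset.sum_congr rfl fun i _ => ?_
  rw [add_comm, Function.iterate_add_apply]

theorem abs_integral_sub_average_le_of_tower {Ω : Type*} [MeasurableSpace Ω]
    [StandardBorelSpace Ω] {μ : Measure Ω} [IsProbabilityMeasure μ] {T S : Ω → Ω} {E : Set Ω}
    (hT : MeasurePreserving T μ μ) (hS : MeasurePreserving S μ μ)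
    (hST : Function.LeftInverse S T) (hTS : Function.LeftInverse T S) (hEm : MeasurableSet E)
    {m P n : ℕ} (hm : 0 < m) (hn : 0 < n) (hnP : n ≤ P)
    (hE : ∀ x ∈ E, ∀ i, 0 < i → i < m * P → T^[i] x ∉ E) {B : Set Ω} (hB : MeasurableSet B)
    {c D b : ℝ} (hD0 : 0 ≤ D) (hb : 0 < b) {t y : ℕ → ℝ}
    (hD : ∀ x ∈ E, ∀ j ≤ m * P,
      |∑ i ∈ Finset.range j, B.indicator (fun _ => (1 : ℝ)) (T^[i] x) - t j| ≤ D)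
    (ht : ∀ i < m, ∀ o, o + n ≤ P → t (i * P + o + n) - t (i * P + o) - c * n = b * y i)
    {φ : ℝ → ℝ} {L : NNReal} {M : ℝ} (hφ : LipschitzWith L φ) (hM : ∀ x, |φ x| ≤ M) :
    |∫ z, φ (b⁻¹ * ∑ i ∈ Finset.range n, (B.indicator (fun _ => (1 : ℝ)) (T^[i] z) - c)) ∂μ
        - (∑ i ∈ Finset.range m, φ (y i)) / m|
      ≤ L * (2 * D / b) + 2 * M * (n / P) + 2 * M * μ.real {z | ∀ j < m * P, S^[j] z ∉ E} := by
  have hP : (0 : ℝ) < P := by exact_mod_cast hn.trans_le hnP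
  have hm' : (0 : ℝ) < m := by exact_mod_cast hm
  have hM0 : 0 ≤ M := (abs_nonneg _).trans (hM 0)
  set Y : Ω → ℝ := fun z =>
    b⁻¹ * ∑ i ∈ Finset.range n, (B.indicator (fun _ => (1 : ℝ)) (T^[i] z) - c) with hY
  have h1m : Measurable (B.indicator (fun _ => (1 : ℝ))) := measurable_const.indicator hB
  have hYm : Measurable Y := (Finset.measurable_sum _ fun i _ =>
    (h1m.comp (hT.measurable.iterate i)).sub_const c).const_mul _
  set v : ℝ := (∑ i ∈ Finset.range m, φ (y i)) / m with hv
  have hvM : |v| ≤ M := by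
    rw [hv, abs_div, Nat.abs_cast, div_le_iff₀ hm']
    refine (Finset.abs_sum_le_sum_abs _ _).trans ((Finset.sum_le_sum fun i _ => hM _).trans ?_)
    simp [mul_comm]
  set f : Ω → ℝ := fun z => φ (Y z) - v with hf
  have hfb : ∀ z, |f z| ≤ 2 * M := fun z => by
    refine (abs_sub _ _).trans ?_
    linarith [hM (Y z)]
  have hφY : Integrable (fun z => φ (Y z)) μ :=
    integrable_of_measurable_of_bound (hφ.continuous.measurable.comp hYm) fun z => hM _
  have hfint : Integrable f μ := hφY.sub (integrable_const v)
  have heq : ∫ z, φ (Y z) ∂μ - v = ∫ z, f z ∂μ := by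
    rw [hf, integral_sub hφY (integrable_const v)]
    simp
  rw [heq, integral_eq_setIntegral_tower hT hS.measurable hST hTS hEm hE hfint]
  have hclose : ∀ x ∈ E, ∀ i < m, ∀ o, o + n ≤ P →
      |φ (Y (T^[i * P + o] x)) - φ (y i)| ≤ L * (2 * D / b) := by
    intro x hx i hi o ho
    have hiP : i * P + P ≤ m * P := by
      rw [← Nat.succ_mul]
      exact Nat.mul_le_mul_right _ hi
    have h1 := hD x hx (i * P + o + n) (by omega)
    have h2 := hD x hx (i * P + o) (by omega)
    have h3 := hφ.dist_le_mul (Y (T^[i * P + o] x)) (y i)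
    rw [Real.dist_eq, Real.dist_eq] at h3
    refine h3.trans (mul_le_mul_of_nonneg_left ?_ L.2)
    have h4 : Y (T^[i * P + o] x) - y i = b⁻¹ *
        ((∑ i ∈ Finset.range (i * P + o + n), B.indicator (fun _ => (1 : ℝ)) (T^[i] x)
          - t (i * P + o + n)) -
        (∑ i ∈ Finset.range (i * P + o), B.indicator (fun _ => (1 : ℝ)) (T^[i] x)
          - t (i * P + o))) := by
      have h5 : y i = b⁻¹ * (t (i * P + o + n) - t (i * P + o) - c * n) := by
        rw [ht i hi o ho]
        field_simp
      rw [hY, h5]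
      simp only
      rw [Finset.sum_sub_distrib, sum_range_iterate_shift]
      simp
      ring
    rw [h4, abs_mul, abs_of_pos (inv_pos.2 hb), div_eq_inv_mul]
    refine mul_le_mul_of_nonneg_left ((abs_sub _ _).trans ?_) (inv_pos.2 hb).le
    linarith
  have hE' : ∀ x ∈ E, ‖∑ j ∈ Finset.range (m * P), f (T^[j] x)‖
      ≤ m * (P * (L * (2 * D / b)) + n * (2 * M)) := by
    intro x hx
    have h1 : ∑ j ∈ Finset.range (m * P), f (T^[j] x) =
        ∑ i ∈ Finset.range m, ∑ o ∈ Finset.range P, (φ (Y (T^[i * P + o] x)) - φ (y i)) := by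
      rw [sum_range_mul_eq, ← sub_eq_zero, ← Finset.sum_sub_distrib]
      simp only [hf, ← Finset.sum_sub_distrib, sub_sub_sub_cancel_left]
      simp only [Finset.sum_const, Finset.card_range, nsmul_eq_mul, ← Finset.mul_sum,
        Finset.sum_sub_distrib]
      rw [hv]
      field_simp
      ring
    rw [h1, Real.norm_eq_abs]
    refine (Finset.abs_sum_le_sum_abs _ _).trans ?_
    have h0 : (m : ℝ) * (P * (L * (2 * D / b)) + n * (2 * M))
        = ∑ _i ∈ Finset.range m, (P * (L * (2 * D / b)) + n * (2 * M)) := by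
      rw [Finset.sum_const, Finset.card_range, nsmul_eq_mul]
    rw [h0]
    refine Finset.sum_le_sum fun i hi => (Finset.abs_sum_le_sum_abs _ _).trans ?_
    have hi := Finset.mem_range.1 hi
    obtain ⟨s, rfl⟩ := Nat.exists_eq_add_of_le' hnP
    have hnn : 0 ≤ (L : ℝ) * (2 * D / b) := (abs_nonneg _).trans (hclose x hx i hi 0 (by omega))
    rw [Finset.sum_range_add]
    refine add_le_add ?_ ?_
    · refine (Finset.sum_le_sum fun o ho => hclose x hx i hi o ?_).trans ?_
      · have := Finset.mem_range.1 ho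
        omega
      · rw [Finset.sum_const, Finset.card_range, nsmul_eq_mul]
        gcongr
        omega
    · refine (Finset.sum_le_sum fun o _ => (abs_sub _ _).trans
        (add_le_add (hM _) (hM _))).trans (le_of_eq ?_)
      rw [Finset.sum_const, Finset.card_range, nsmul_eq_mul]
      ring
  have hbase := mul_measure_base_le_one hS hTS hEm hE
  push_cast at hbase
  refine (abs_add_le _ _).trans (add_le_add ?_ ?_)
  · have h1 := norm_setIntegral_le_of_norm_le_const (measure_lt_top μ E) hE'
    rw [Real.norm_eq_abs] at h1
    refine h1.trans ?_
    have hL : 0 ≤ (L : ℝ) := L.2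
    calc (m : ℝ) * (P * (L * (2 * D / b)) + n * (2 * M)) * μ.real E
        = (m * P * μ.real E) * (L * (2 * D / b) + 2 * M * (n / P)) := by
          field_simp
      _ ≤ 1 * (L * (2 * D / b) + 2 * M * (n / P)) := by
          gcongr
      _ = _ := one_mul _
  · have h1 := norm_setIntegral_le_of_norm_le_const (f := f)
      (measure_lt_top μ {z | ∀ j < m * P, S^[j] z ∉ E}) fun z _ => hfb z
    rwa [Real.norm_eq_abs] at h1

/-- A walk with drift `c`, perturbed on the `i`-th block of length `P` by the slope `d * x i`. -/
noncomputable def blockWalk (c d : ℝ) (x : ℕ → ℝ) (P j : ℕ) : ℝ :=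
  c * j + d * ∑ i ∈ Finset.range j, x (i / P)

theorem blockWalk_add_sub (c d : ℝ) (x : ℕ → ℝ) (P j n : ℕ) :
    blockWalk c d x P (j + n) - blockWalk c d x P j - c * n
      = d * ∑ i ∈ Finset.range n, x ((j + i) / P) := by
  rw [blockWalk, blockWalk, Finset.sum_range_add]
  push_cast
  ring

theorem blockWalk_add_sub_of_le (c d : ℝ) (x : ℕ → ℝ) {P o n : ℕ} (i : ℕ) (ho : o + n ≤ P) :
    blockWalk c d x P (i * P + o + n) - blockWalk c d x P (i * P + o) - c * n = d * n * x i := by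
  rw [blockWalk_add_sub, Finset.sum_congr rfl (g := fun _ => x i), Finset.sum_const,
    Finset.card_range, nsmul_eq_mul, mul_assoc]
  intro k hk
  have hk := Finset.mem_range.1 hk
  rw [add_assoc, mul_comm, Nat.mul_add_div (by omega), Nat.div_eq_of_lt (by omega), add_zero]

theorem abs_blockWalk_add_sub_le {c d R : ℝ} (hd : 0 ≤ d) {x : ℕ → ℝ} (hx : ∀ i, |x i| ≤ R)
    (P j n : ℕ) :
    |blockWalk c d x P (j + n) - blockWalk c d x P j - c * n| ≤ d * R * n := by
  rw [blockWalk_add_sub, abs_mul, abs_of_nonneg hd, mul_assoc]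
  refine mul_le_mul_of_nonneg_left ((Finset.abs_sum_le_sum_abs _ _).trans
    ((Finset.sum_le_sum fun i _ => hx _).trans ?_)) hd
  simp [mul_comm]

theorem blockWalk_mul {c d : ℝ} {x : ℕ → ℝ} {m P : ℕ} (hx : ∑ i ∈ Finset.range m, x i = 0) :
    blockWalk c d x P (m * P) = c * ↑(m * P) := by
  have h : ∀ i, ∑ o ∈ Finset.range P, x ((i * P + o) / P) = P * x i := by
    intro i
    rw [Finset.sum_congr rfl (g := fun _ => x i), Finset.sum_const, Finset.card_range,
      nsmul_eq_mul]
    intro k hk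
    have hk := Finset.mem_range.1 hk
    rw [mul_comm, Nat.mul_add_div (by omega), Nat.div_eq_of_lt hk, add_zero]
  rw [blockWalk, sum_range_mul_eq, Finset.sum_congr rfl fun i _ => h i, ← Finset.mul_sum, hx]
  simp

/-- A set whose indicator is nearly cohomologous to its mean can be modified on a set of small
measure so that its centred partial sums at a suitable time nearly follow a given centred finite
rational distribution, while being as close as desired to a coboundary. -/
theorem exists_modification_tracking_list {Ω : Type*} [MeasurableSpace Ω] [StandardBorelSpace Ω]
    {μ : Measure Ω} [IsProbabilityMeasure μ] {T S : Ω → Ω} (hT : MeasurePreserving T μ μ)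
    (hS : MeasurePreserving S μ μ) (hST : Function.LeftInverse S T)
    (hTS : Function.LeftInverse T S) (haper : μ {x | ∃ n ≥ 1, T^[n] x = x} = 0)
    {a : ℕ → ℝ} (ha_pos : ∀ n, 0 < a n) (ha_top : Tendsto a atTop atTop)
    (ha_small : Tendsto (fun n => a n / n) atTop (𝓝 0))
    {A : Set Ω} (hA : MeasurableSet A) {c η : ℝ} (hc0 : 0 < c) (hc1 : c < 1)
    (hAc : IsNearCoboundary μ T A c η) {l : List ℚ} (hl : l ≠ [])
    (hsum : ∑ i ∈ Finset.range l.length, l.getD i 0 = 0) {δ : ℝ} (hδ : 0 < δ) (N : ℕ) :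
    ∃ n > N, ∀ η' > 0, ∃ B, MeasurableSet B ∧ IsNearCoboundary μ T B c η' ∧
      ∫ z, |A.indicator (fun _ => (1 : ℝ)) z - B.indicator (fun _ => (1 : ℝ)) z| ∂μ ≤ η + δ ∧
      ∀ (φ : ℝ → ℝ) (L : NNReal) (M : ℝ), LipschitzWith L φ → (∀ x, |φ x| ≤ M) →
        |∫ z, φ ((a n)⁻¹ * ∑ i ∈ Finset.range n, (B.indicator (fun _ => (1 : ℝ)) (T^[i] z) - c)) ∂μ
          - listAverage l φ| ≤ δ * (L + M) := by
  obtain ⟨g, hgm, ⟨K, hK⟩, hgη⟩ := hAc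
  have hK0 : 0 ≤ K := by
    obtain ⟨x⟩ : Nonempty Ω := nonempty_of_isProbabilityMeasure μ
    exact (abs_nonneg _).trans (hK x)
  set m := l.length with hm
  have hm0 : 0 < m := List.length_pos_iff.2 hl
  let x : ℕ → ℝ := fun i => ((l.getD i 0 : ℚ) : ℝ)
  have hxsum : ∑ i ∈ Finset.range m, x i = 0 := by
    simp only [x]
    exact_mod_cast hsum
  set R : ℝ := ∑ i ∈ Finset.range m, |x i| with hR
  have hR0 : 0 ≤ R := Finset.sum_nonneg fun _ _ => abs_nonneg _
  have hxR : ∀ i, |x i| ≤ R := by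
    intro i
    by_cases hi : i < m
    · exact Finset.single_le_sum (f := fun i => |x i|) (fun _ _ => abs_nonneg _)
        (Finset.mem_range.2 hi)
    · have : x i = 0 := by
        simp only [x]
        rw [List.getD_eq_default _ _ (not_lt.1 hi), Rat.cast_zero]
      rw [this, abs_zero]
      exact hR0
  obtain ⟨ℓ, hℓ⟩ := exists_nat_gt ((2 * K + 1) / (δ / 3))
  have hℓ0 : (0 : ℝ) < ℓ := lt_of_le_of_lt (by positivity) hℓ
  have hℓ0' : 0 < ℓ := by exact_mod_cast hℓ0
  have hℓδ : (2 * K + 1) / ℓ ≤ δ / 3 := by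
    rw [div_le_iff₀ hℓ0]
    rw [div_lt_iff₀ (by positivity)] at hℓ
    linarith
  have hev : ∀ᶠ n in atTop, a n / n * R < min (δ / 3) (min c (1 - c)) := by
    have h1 := ha_small.mul_const R
    rw [zero_mul] at h1
    refine h1.eventually_lt_const ?_
    exact lt_min (by positivity) (lt_min hc0 (by linarith))
  obtain ⟨n, ⟨hnR, hna⟩, hnN⟩ := ((hev.and (ha_top.eventually_ge_atTop
    (2 * (ℓ + 1) / δ))).and (eventually_gt_atTop N)).exists
  have hn0 : 0 < n := by omega
  have hn0' : (0 : ℝ) < n := by exact_mod_cast hn0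
  have hρδ := (hnR.trans_le (min_le_left _ _)).le
  have hρc := (hnR.trans_le ((min_le_right _ _).trans (min_le_left _ _))).le
  have hρc' := (hnR.trans_le ((min_le_right _ _).trans (min_le_right _ _))).le
  set b := a n with hb
  have hb0 : 0 < b := ha_pos n
  have hd0 : 0 ≤ b / n := by positivity
  refine ⟨n, hnN, fun η' hη' => ?_⟩
  obtain ⟨q, hq⟩ := exists_nat_gt (max (n : ℝ) (max (4 * n / δ) (2 * (ℓ + 1) / η')))
  have hqn : n ≤ q := by exact_mod_cast ((le_max_left _ _).trans_lt hq).le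
  have hqδ : 4 * n / δ ≤ q := ((le_max_left _ _).trans ((le_max_right _ _).trans_lt hq).le)
  have hqη : 2 * (ℓ + 1) / η' ≤ q :=
    ((le_max_right _ _).trans ((le_max_right _ _).trans_lt hq).le)
  have hq0 : 0 < q := by omega
  have hq0' : (0 : ℝ) < q := by exact_mod_cast hq0
  have hqP : q ≤ q * ℓ := Nat.le_mul_of_pos_right _ hℓ0'
  have hH0 : 0 < m * (q * ℓ) := by positivity
  have hr0 : 0 < min (δ / 4) (η' / 2) := lt_min (by positivity) (by positivity)
  obtain ⟨E, hEm, hE, hoff⟩ := exists_rokhlin_tower hT hS hST hTS haper hH0 hr0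
  set t := blockWalk c (b / n) x (q * ℓ) with ht
  have hstep : ∀ j, |t (j + 1) - t j - c| ≤ b / n * R := by
    intro j
    simpa using abs_blockWalk_add_sub_le (c := c) hd0 hxR (q * ℓ) j 1
  have hassoc : m * (q * ℓ) = m * q * ℓ := (mul_assoc _ _ _).symm
  obtain ⟨B, hB, hBt, hBcost⟩ := exists_tower_modification (Q := m * q) (ℓ := ℓ) (t := t)
    hT.measurable hS.measurable hST hTS hEm (by rwa [← hassoc]) hA (by simp [ht, blockWalk])
    (fun j => by linarith [(abs_le.1 (hstep j)).1]) (fun j => by linarith [(abs_le.1 (hstep j)).2])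
  rw [← hassoc] at hBt hBcost
  refine ⟨B, hB, ?_, ?_, fun φ L M hφ hM => ?_⟩
  · obtain ⟨g', hg', hgK', hint⟩ := isNearCoboundary_of_tower hT hS.measurable hST hTS hEm hE hB
      hc0.le hc1.le (D := ℓ + 1) hH0 fun x hx => by
        have := hBt x hx _ le_rfl
        rwa [ht, blockWalk_mul hxsum] at this
    refine ⟨g', hg', hgK', hint.trans ?_⟩
    have h1 := mul_measure_base_le_one hS hTS hEm hE
    have h2 : (q : ℝ) * μ.real E ≤ 1 := by
      refine le_trans ?_ h1
      gcongr
      exact hqP.trans (Nat.le_mul_of_pos_left _ hm0)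
    have h3 : 2 * (ℓ + 1 : ℝ) ≤ q * η' := (div_le_iff₀ hη').1 hqη
    have h4 := hoff.trans (min_le_right _ _)
    have h5 : (ℓ + 1) * μ.real E ≤ η' / 2 := by
      calc (ℓ + 1) * μ.real E ≤ q * η' / 2 * μ.real E := by gcongr; linarith
        _ = (q * μ.real E) * (η' / 2) := by ring
        _ ≤ 1 * (η' / 2) := by gcongr
        _ = η' / 2 := one_mul _
    linarith
  · rw [hassoc] at hE hBcost hoff
    have h1 := integral_abs_indicator_sub_le_of_tower hT hS hST hTS hEm hℓ0' hE hA hB hgm hK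
      (c := c) (mul_nonneg hd0 hR0) (fun p => abs_blockWalk_add_sub_le hd0 hxR (q * ℓ) (p * ℓ) ℓ) hBcost
    have h4 := hoff.trans (min_le_left _ _)
    linarith
  · have h1 := abs_integral_sub_average_le_of_tower (y := x) (b := b) hT hS hST hTS hEm hm0 hn0
      (hqn.trans hqP) hE hB (by positivity) hb0 hBt (fun i _ o ho => by
        rw [ht, blockWalk_add_sub_of_le c (b / n) x i ho]
        field_simp) hφ hM
    refine h1.trans ?_
    have hM0 : 0 ≤ M := (abs_nonneg _).trans (hM 0)
    have h2 : 2 * (ℓ + 1 : ℝ) / b ≤ δ := by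
      rw [div_le_iff₀ hb0]
      rw [div_le_iff₀ hδ] at hna
      linarith
    have h3 : (n : ℝ) / ↑(q * ℓ) ≤ δ / 4 := by
      calc (n : ℝ) / ↑(q * ℓ) ≤ n / q := by
            gcongr
        _ ≤ δ / 4 := by
            rw [div_le_iff₀ hq0']
            rw [div_le_iff₀ hδ] at hqδ
            linarith
    have h4 := hoff.trans (min_le_left _ _)
    have hL : 0 ≤ (L : ℝ) := L.2
    calc L * (2 * (ℓ + 1) / b) + 2 * M * (n / ↑(q * ℓ))
          + 2 * M * μ.real {z | ∀ j < m * (q * ℓ), S^[j] z ∉ E}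
        ≤ L * δ + 2 * M * (δ / 4) + 2 * M * (δ / 4) := by gcongr
      _ = δ * (L + M) := by ring

theorem integral_abs_indicator_sub {Ω : Type*} [MeasurableSpace Ω] {μ : Measure Ω} {A B : Set Ω}
    (hA : MeasurableSet A) (hB : MeasurableSet B) :
    ∫ z, |A.indicator (fun _ => (1 : ℝ)) z - B.indicator (fun _ => (1 : ℝ)) z| ∂μ
      = μ.real (symmDiff A B) := by
  rw [← integral_indicator_one (hA.symmDiff hB)]
  refine integral_congr_ae (.of_forall fun z => ?_)
  by_cases h1 : z ∈ A <;> by_cases h2 : z ∈ B <;> simp [h1, h2, mem_symmDiff]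

theorem integrable_abs_indicator_sub {Ω : Type*} [MeasurableSpace Ω] {μ : Measure Ω}
    [IsFiniteMeasure μ] {A B : Set Ω} (hA : MeasurableSet A) (hB : MeasurableSet B) :
    Integrable
      (fun z => |A.indicator (fun _ => (1 : ℝ)) z - B.indicator (fun _ => (1 : ℝ)) z|) μ :=
  (((integrable_const (1 : ℝ)).indicator hA).sub ((integrable_const (1 : ℝ)).indicator hB)).abs

theorem abs_measureReal_sub_le {Ω : Type*} [MeasurableSpace Ω] {μ : Measure Ω}
    [IsFiniteMeasure μ] {A B : Set Ω} (hA : MeasurableSet A) (hB : MeasurableSet B) :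
    |μ.real A - μ.real B| ≤
      ∫ z, |A.indicator (fun _ => (1 : ℝ)) z - B.indicator (fun _ => (1 : ℝ)) z| ∂μ := by
  have h1 : ∀ {s : Set Ω}, MeasurableSet s → ∫ z, s.indicator (fun _ => (1 : ℝ)) z ∂μ = μ.real s :=
    fun hs => integral_indicator_one hs
  rw [← h1 hA, ← h1 hB, ← integral_sub ((integrable_const (1 : ℝ)).indicator hA)
    ((integrable_const (1 : ℝ)).indicator hB)]
  exact abs_integral_le_integral_abs

theorem IsNearCoboundary.abs_measureReal_sub_le {Ω : Type*} [MeasurableSpace Ω] {μ : Measure Ω}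
    [IsProbabilityMeasure μ] {T : Ω → Ω} (hT : MeasurePreserving T μ μ) {A : Set Ω}
    (hA : MeasurableSet A) {c η : ℝ} (h : IsNearCoboundary μ T A c η) : |μ.real A - c| ≤ η := by
  obtain ⟨g, hgm, ⟨K, hK⟩, hη⟩ := h
  have hg : Integrable g μ := integrable_of_measurable_of_bound hgm hK
  have hgT : Integrable (fun x => g (T x)) μ := hT.integrable_comp_of_integrable hg
  have hA1 : Integrable (A.indicator (fun _ => (1 : ℝ))) μ := (integrable_const _).indicator hA
  have h1 : ∫ x, g (T x) ∂μ = ∫ x, g x ∂μ := by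
    rw [← integral_map hT.measurable.aemeasurable (by rw [hT.map_eq]; exact hg.1), hT.map_eq]
  have h2 : ∫ z, A.indicator (fun _ => (1 : ℝ)) z ∂μ = μ.real A := integral_indicator_one hA
  have h3 : μ.real A - c = ∫ x, (A.indicator (fun _ => (1 : ℝ)) x - c - (g (T x) - g x)) ∂μ := by
    rw [integral_sub (f := fun x => A.indicator (fun _ => (1 : ℝ)) x - c)
      (g := fun x => g (T x) - g x) (hA1.sub (integrable_const c)) (hgT.sub hg),
      integral_sub hA1 (integrable_const c), integral_sub hgT hg, h1, h2]
    simp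
  rw [h3]
  exact abs_integral_le_integral_abs.trans hη

theorem exists_limit_set {Ω : Type*} [MeasurableSpace Ω] {μ : Measure Ω} [IsFiniteMeasure μ]
    {A : ℕ → Set Ω} (hA : ∀ k, MeasurableSet (A k)) {β : ℕ → ℝ}
    (hβ : ∀ k, β (k + 1) ≤ β k / 2)
    (h : ∀ k, ∫ z, |(A k).indicator (fun _ => (1 : ℝ)) z
      - (A (k + 1)).indicator (fun _ => (1 : ℝ)) z| ∂μ ≤ β k) :
    ∃ B, MeasurableSet B ∧ ∀ k, ∫ z, |B.indicator (fun _ => (1 : ℝ)) z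
      - (A k).indicator (fun _ => (1 : ℝ)) z| ∂μ ≤ 2 * β k := by
  have hB : MeasurableSet (⋃ K, ⋂ k, A (K + k)) :=
    MeasurableSet.iUnion fun K => MeasurableSet.iInter fun k => hA _
  refine ⟨_, hB, fun k => ?_⟩
  have hβ0 : ∀ k, 0 ≤ β k := fun k => (integral_nonneg fun z => abs_nonneg _).trans (h k)
  rw [integral_abs_indicator_sub hB (hA k)]
  have hsub : symmDiff (⋃ K, ⋂ k, A (K + k)) (A k) ⊆ ⋃ i, symmDiff (A (k + i)) (A (k + i + 1)) := by
    intro x hx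
    by_contra hcon
    simp only [mem_iUnion, not_exists, mem_symmDiff, not_or, not_and, not_not] at hcon
    have hiff : ∀ i, x ∈ A (k + i) ↔ x ∈ A k := by
      intro i
      induction i with
      | zero => rfl
      | succ i ih => rw [← ih]; exact ⟨(hcon i).2, (hcon i).1⟩
    have : x ∈ (⋃ K, ⋂ k, A (K + k)) ↔ x ∈ A k := by
      simp only [mem_iUnion, mem_iInter]
      constructor
      · rintro ⟨K, hK⟩
        have := hK k
        rw [add_comm] at this
        exact (hiff K).1 this
      · exact fun hx => ⟨k, fun i => (hiff i).2 hx⟩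
    rw [mem_symmDiff] at hx
    tauto
  have hgeo : ∀ i, β (k + i) ≤ β k * (1 / 2) ^ i := by
    intro i
    induction i with
    | zero => simp
    | succ i ih =>
      rw [← add_assoc, pow_succ]
      linarith [hβ (k + i)]
  have hterm : ∀ i, μ (symmDiff (A (k + i)) (A (k + i + 1))) ≤
      ENNReal.ofReal (β k * (1 / 2) ^ i) := by
    intro i
    rw [← ofReal_measureReal]
    refine ENNReal.ofReal_le_ofReal ?_
    rw [← integral_abs_indicator_sub (hA _) (hA _)]
    exact (h _).trans (hgeo i)
  have hsum : HasSum (fun i : ℕ => β k * (1 / 2 : ℝ) ^ i) (2 * β k) := by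
    rw [mul_comm]
    exact hasSum_geometric_two.mul_left _
  refine ENNReal.toReal_le_of_le_ofReal (by linarith [hβ0 k]) ?_
  calc μ (symmDiff (⋃ K, ⋂ k, A (K + k)) (A k))
      ≤ μ (⋃ i, symmDiff (A (k + i)) (A (k + i + 1))) := measure_mono hsub
    _ ≤ ∑' i, μ (symmDiff (A (k + i)) (A (k + i + 1))) := measure_iUnion_le _
    _ ≤ ∑' i, ENNReal.ofReal (β k * (1 / 2) ^ i) := ENNReal.tsum_le_tsum hterm
    _ = ENNReal.ofReal (2 * β k) := by
      rw [← ENNReal.ofReal_tsum_of_nonneg (fun i => mul_nonneg (hβ0 k) (by positivity))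
        hsum.summable, hsum.tsum_eq]

theorem measurable_normalized_sum {Ω : Type*} [MeasurableSpace Ω] {T : Ω → Ω} (hT : Measurable T)
    {A : Set Ω} (hA : MeasurableSet A) (b c : ℝ) (n : ℕ) :
    Measurable fun z =>
      b * ∑ i ∈ Finset.range n, (A.indicator (fun _ => (1 : ℝ)) (T^[i] z) - c) :=
  (Finset.measurable_sum _ fun i _ =>
    ((measurable_const.indicator hA).comp (hT.iterate i)).sub_const c).const_mul _

theorem abs_integral_normalized_sum_sub_le {Ω : Type*} [MeasurableSpace Ω] {μ : Measure Ω}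
    [IsProbabilityMeasure μ] {T : Ω → Ω} (hT : MeasurePreserving T μ μ) {A B : Set Ω}
    (hA : MeasurableSet A) (hB : MeasurableSet B) {b : ℝ} (hb : 0 ≤ b) (c : ℝ) (n : ℕ)
    {φ : ℝ → ℝ} {L : NNReal} {M : ℝ} (hφ : LipschitzWith L φ) (hM : ∀ x, |φ x| ≤ M) :
    |∫ z, φ (b * ∑ i ∈ Finset.range n, (A.indicator (fun _ => (1 : ℝ)) (T^[i] z) - c)) ∂μ
      - ∫ z, φ (b * ∑ i ∈ Finset.range n, (B.indicator (fun _ => (1 : ℝ)) (T^[i] z) - c)) ∂μ|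
    ≤ L * (b * (n * ∫ z, |A.indicator (fun _ => (1 : ℝ)) z
      - B.indicator (fun _ => (1 : ℝ)) z| ∂μ)) := by
  have hint : ∀ {C : Set Ω}, MeasurableSet C → Integrable (fun z =>
      φ (b * ∑ i ∈ Finset.range n, (C.indicator (fun _ => (1 : ℝ)) (T^[i] z) - c))) μ := fun hC =>
    integrable_of_measurable_of_bound
      (hφ.continuous.measurable.comp (measurable_normalized_sum hT.measurable hC b c n))
      fun z => hM _
  have hd := integrable_abs_indicator_sub (μ := μ) hA hB
  have hdi : ∀ i, Integrable (fun z => |A.indicator (fun _ => (1 : ℝ)) (T^[i] z)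
      - B.indicator (fun _ => (1 : ℝ)) (T^[i] z)|) μ := fun i =>
    (hT.iterate i).integrable_comp_of_integrable hd
  have hdeq : ∀ i, ∫ z, |A.indicator (fun _ => (1 : ℝ)) (T^[i] z)
      - B.indicator (fun _ => (1 : ℝ)) (T^[i] z)| ∂μ = ∫ z, |A.indicator (fun _ => (1 : ℝ)) z
      - B.indicator (fun _ => (1 : ℝ)) z| ∂μ := fun i => by
    have := integral_map (μ := μ) (hT.iterate i).measurable.aemeasurable
      (by rw [(hT.iterate i).map_eq]; exact hd.1)
    rw [(hT.iterate i).map_eq] at this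
    exact this.symm
  rw [← integral_sub (hint hA) (hint hB)]
  refine abs_integral_le_integral_abs.trans ?_
  calc _ ≤ ∫ z, L * (b * ∑ i ∈ Finset.range n, |A.indicator (fun _ => (1 : ℝ)) (T^[i] z)
          - B.indicator (fun _ => (1 : ℝ)) (T^[i] z)|) ∂μ := by
        refine integral_mono ((hint hA).sub (hint hB)).abs
          (((integrable_finsetSum _ fun i _ => hdi i).const_mul b).const_mul _) fun z => ?_
        have h1 := hφ.dist_le_mul
          (b * ∑ i ∈ Finset.range n, (A.indicator (fun _ => (1 : ℝ)) (T^[i] z) - c))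
          (b * ∑ i ∈ Finset.range n, (B.indicator (fun _ => (1 : ℝ)) (T^[i] z) - c))
        rw [Real.dist_eq, Real.dist_eq, ← mul_sub, ← Finset.sum_sub_distrib, abs_mul,
          abs_of_nonneg hb] at h1
        refine h1.trans (mul_le_mul_of_nonneg_left (mul_le_mul_of_nonneg_left ?_ hb) L.2)
        refine (Finset.abs_sum_le_sum_abs _ _).trans (le_of_eq ?_)
        simp only [sub_sub_sub_cancel_right]
    _ = _ := by
        rw [integral_const_mul, integral_const_mul, integral_finsetSum _ fun i _ => hdi i,
          Finset.sum_congr rfl fun i _ => hdeq i]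
        simp

theorem exists_set_tracking_enumeration {Ω : Type*} [MeasurableSpace Ω] [StandardBorelSpace Ω]
    {μ : Measure Ω} [IsProbabilityMeasure μ] {T S : Ω → Ω} (hT : MeasurePreserving T μ μ)
    (hS : MeasurePreserving S μ μ) (hST : Function.LeftInverse S T)
    (hTS : Function.LeftInverse T S) (haper : μ {x | ∃ n ≥ 1, T^[n] x = x} = 0)
    {a : ℕ → ℝ} (ha_pos : ∀ n, 0 < a n) (ha_top : Tendsto a atTop atTop)
    (ha_small : Tendsto (fun n => a n / n) atTop (𝓝 0)) {c : ℝ} (hc0 : 0 < c) (hc1 : c < 1)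
    {e : ℕ → List ℚ}
    (he : ∀ k, e k ≠ [] ∧ ∑ i ∈ Finset.range (e k).length, (e k).getD i 0 = 0) :
    ∃ A, MeasurableSet A ∧ μ.real A = c ∧ ∃ n : ℕ → ℕ, StrictMono n ∧ (∀ k, 1 ≤ n k) ∧
      ∀ (φ : ℝ → ℝ) (L : NNReal) (M : ℝ), LipschitzWith L φ → (∀ x, |φ x| ≤ M) →
        Tendsto (fun k => ∫ z, φ ((a (n k))⁻¹ * ∑ i ∈ Finset.range (n k),
          (A.indicator (fun _ => (1 : ℝ)) (T^[i] z) - c)) ∂μ - listAverage (e k) φ)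
          atTop (𝓝 0) := by
  let σ := {s : Set Ω × ℝ × ℕ //
    MeasurableSet s.1 ∧ 0 < s.2.1 ∧ IsNearCoboundary μ T s.1 c (s.2.1 / 2)}
  have hstep : ∀ (k : ℕ) (s : σ), ∃ s' : σ, s.1.2.2 < s'.1.2.2 ∧ s'.1.2.1 ≤ s.1.2.1 / 2 ∧
      s'.1.2.1 ≤ 1 / (k + 1) * (a s'.1.2.2 / s'.1.2.2) ∧
      ∫ z, |s.1.1.indicator (fun _ => (1 : ℝ)) z - s'.1.1.indicator (fun _ => (1 : ℝ)) z| ∂μ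
        ≤ s.1.2.1 ∧
      ∀ (φ : ℝ → ℝ) (L : NNReal) (M : ℝ), LipschitzWith L φ → (∀ x, |φ x| ≤ M) →
        |∫ z, φ ((a s'.1.2.2)⁻¹ * ∑ i ∈ Finset.range s'.1.2.2,
          (s'.1.1.indicator (fun _ => (1 : ℝ)) (T^[i] z) - c)) ∂μ - listAverage (e k) φ|
          ≤ 1 / (k + 1) * (L + M) := by
    rintro k ⟨⟨A, β, N⟩, hA, hβ, hAc⟩
    simp only at hA hβ hAc
    obtain ⟨n, hnN, hn⟩ := exists_modification_tracking_list hT hS hST hTS haper ha_pos ha_top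
      ha_small hA hc0 hc1 hAc (he k).1 (he k).2
      (lt_min (half_pos hβ) (Nat.one_div_pos_of_nat (n := k) (α := ℝ))) N
    have hn0 : (0 : ℝ) < n := by exact_mod_cast (Nat.zero_le N).trans_lt hnN
    have hβ' : 0 < min (β / 2) (1 / (k + 1 : ℝ) * (a n / n)) :=
      lt_min (half_pos hβ) (mul_pos Nat.one_div_pos_of_nat (div_pos (ha_pos n) hn0))
    obtain ⟨B, hB, hBc, hAB, hφ⟩ := hn _ (half_pos hβ')
    refine ⟨⟨⟨B, _, n⟩, hB, hβ', hBc⟩, hnN, min_le_left _ _, min_le_right _ _, ?_, ?_⟩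
    · have := min_le_left (β / 2) (1 / ((k : ℝ) + 1))
      simp only
      linarith
    · intro φ L M hL hM
      refine (hφ φ L M hL hM).trans (mul_le_mul_of_nonneg_right (min_le_right _ _) ?_)
      exact add_nonneg L.2 ((abs_nonneg _).trans (hM 0))
  choose F hFn hFβ hFa hFd hFφ using hstep
  have h0 : IsNearCoboundary μ T ∅ c (2 * c / 2) := by
    refine ⟨fun _ => 0, measurable_const, ⟨0, by simp⟩, ?_⟩
    simp [abs_of_pos hc0]
  let s : ℕ → σ := fun k => Nat.rec ⟨⟨∅, 2 * c, 0⟩, .empty, by positivity, h0⟩ F k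
  have hs : ∀ k, s (k + 1) = F k (s k) := fun k => rfl
  have hβhalf : ∀ k, (s (k + 1)).1.2.1 ≤ (s k).1.2.1 / 2 := fun k => hFβ k (s k)
  obtain ⟨A, hA, hAk⟩ := exists_limit_set (A := fun k => (s k).1.1)
    (fun k => (s k).2.1) (β := fun k => (s k).1.2.1) hβhalf fun k => hFd k (s k)
  have hβpow : ∀ k, (s k).1.2.1 ≤ 2 * c * (1 / 2) ^ k := by
    intro k
    induction k with
    | zero => simp [s]
    | succ k ih =>
      rw [pow_succ]
      linarith [hβhalf k]
  have hμA : μ.real A = c := by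
    have h1 : ∀ k : ℕ, |μ.real A - c| ≤ 3 * (2 * c * (1 / 2) ^ k) := by
      intro k
      have h2 := (abs_measureReal_sub_le (μ := μ) hA (s k).2.1).trans (hAk k)
      have h3 := (s k).2.2.2.abs_measureReal_sub_le hT (s k).2.1
      have h4 := abs_sub_le (μ.real A) (μ.real (s k).1.1) c
      linarith [hβpow k, (s k).2.2.1]
    have h5 : Tendsto (fun k : ℕ => 3 * (2 * c * (1 / 2 : ℝ) ^ k)) atTop (𝓝 (3 * (2 * c * 0))) :=
      ((tendsto_pow_atTop_nhds_zero_of_lt_one (by norm_num) (by norm_num)).const_mul _).const_mul _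
    have h6 := ge_of_tendsto' h5 h1
    simp only [mul_zero] at h6
    exact sub_eq_zero.1 (abs_nonpos_iff.1 h6)
  have hmono : StrictMono fun k => (s k).1.2.2 := strictMono_nat_of_lt_succ fun k => hFn k (s k)
  refine ⟨A, hA, hμA, fun k => (s (k + 1)).1.2.2, fun i j hij => hmono (Nat.succ_lt_succ hij),
    fun k => (Nat.zero_le _).trans_lt (hFn k (s k)), fun φ L M hφ hM => ?_⟩
  have hlim : Tendsto (fun k : ℕ => (1 / ((k : ℝ) + 1)) * (3 * L + M)) atTop (𝓝 0) := by
    simpa using tendsto_one_div_add_atTop_nhds_zero_nat.mul_const (3 * (L : ℝ) + M)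
  refine squeeze_zero_norm (fun k => ?_) hlim
  rw [Real.norm_eq_abs]
  have h1 := hFφ k (s k) φ L M hφ hM
  rw [← hs] at h1
  have hn0 : (0 : ℝ) < ((s (k + 1)).1.2.2 : ℕ) := by
    exact_mod_cast (Nat.zero_le _).trans_lt (hFn k (s k))
  have ha0 := ha_pos (s (k + 1)).1.2.2
  have h2 := abs_integral_normalized_sum_sub_le hT hA (s (k + 1)).2.1
    (inv_nonneg.2 ha0.le) c (s (k + 1)).1.2.2 hφ hM
  have h3 := hFa k (s k)
  rw [← hs] at h3
  have h4 := (hAk (k + 1)).trans (mul_le_mul_of_nonneg_left h3 two_pos.le)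
  have h5 : (L : ℝ) * ((a (s (k + 1)).1.2.2)⁻¹ * ((s (k + 1)).1.2.2 *
      ∫ z, |A.indicator (fun _ => (1 : ℝ)) z
        - (s (k + 1)).1.1.indicator (fun _ => (1 : ℝ)) z| ∂μ)) ≤ L * (2 * (1 / (k + 1))) := by
    refine mul_le_mul_of_nonneg_left ?_ L.2
    calc _ ≤ (a (s (k + 1)).1.2.2)⁻¹ * ((s (k + 1)).1.2.2 *
          (2 * (1 / (k + 1) * (a (s (k + 1)).1.2.2 / (s (k + 1)).1.2.2)))) := by gcongr
      _ = 2 * (1 / (k + 1)) := by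
        field_simp
  refine (abs_sub_le _ _ _).trans ((add_le_add (h2.trans h5) h1).trans (le_of_eq ?_))
  ring

/-- In every aperiodic dynamical system on a standard Borel probability
space, for every normalizing sequence `a n` with `a n → ∞` and `a n / n → 0`, and every
`ε > 0`, there is a measurable set `A` with `μ A < ε` such that for every Borel
probability measure `ν` on `ℝ` some subsequence of the normalized partial sums of the
centered indicator of `A` converges in distribution to `ν`. -/
theorem indicator_limit_aperiodic
    {Ω : Type*} [MeasurableSpace Ω] [StandardBorelSpace Ω]
    (μ : Measure Ω) [IsProbabilityMeasure μ]
    (T : Ω → Ω) (hT : MeasurePreserving T μ μ) (hTbij : Function.Bijective T)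
    (haper : μ {x | ∃ n ≥ 1, T^[n] x = x} = 0)
    (a : ℕ → ℝ) (ha_pos : ∀ n, 0 < a n) (ha_mono : Monotone a)
    (ha_top : Tendsto a atTop atTop)
    (ha_small : Tendsto (fun n => a n / n) atTop (𝓝 0))
    (ε : ℝ) (hε : 0 < ε) :
    ∃ A : Set Ω, MeasurableSet A ∧ μ A < ENNReal.ofReal ε ∧
      ∀ ν : Measure ℝ, IsProbabilityMeasure ν →
        ∃ n : ℕ → ℕ, StrictMono n ∧ (∀ k, 1 ≤ n k) ∧
          ∀ φ : ℝ →ᵇ ℝ,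
            Tendsto
              (fun k => ∫ x, φ ((a (n k))⁻¹ *
                ∑ i ∈ Finset.range (n k),
                  (A.indicator (fun _ => (1 : ℝ)) (T^[i] x) - (μ A).toReal)) ∂μ)
              atTop (𝓝 (∫ y, φ y ∂ν)) := by
  have hemb := hT.measurable.measurableEmbedding hTbij.injective
  let Te : Ω ≃ᵐ Ω := ⟨Equiv.ofBijective T hTbij, hT.measurable, fun s hs => by
    rw [← Equiv.image_eq_preimage_symm]
    exact hemb.measurableSet_image.2 hs⟩
  have hS : MeasurePreserving Te.symm μ μ := hT.symm Te
  obtain ⟨e, he, hfreq⟩ := exists_enumeration_of_centered_lists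
  have hc0 : 0 < min (ε / 2) (1 / 2) := lt_min (half_pos hε) (by norm_num)
  obtain ⟨A, hA, hμA, n, hn, hn1, hlim⟩ := exists_set_tracking_enumeration hT hS
    Te.symm_apply_apply Te.apply_symm_apply haper ha_pos ha_top ha_small hc0
    ((min_le_right _ _).trans_lt (by norm_num)) he
  refine ⟨A, hA, ?_, fun ν hν => ?_⟩
  · rw [← ofReal_measureReal, hμA]
    exact (ENNReal.ofReal_lt_ofReal_iff hε).2 ((min_le_left _ _).trans_lt (half_lt_self hε))
  · rw [← measureReal_def, hμA]
    have hm := fun k => measurable_normalized_sum hT.measurable hA (a (n k))⁻¹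
      (min (ε / 2) (1 / 2)) (n k)
    have hmap : ∀ k (φ : ℝ → ℝ), Continuous φ → ∫ y, φ y ∂(μ.map fun z => (a (n k))⁻¹ *
        ∑ i ∈ Finset.range (n k), (A.indicator (fun _ => (1 : ℝ)) (T^[i] z) - min (ε / 2) (1 / 2)))
        = ∫ z, φ ((a (n k))⁻¹ * ∑ i ∈ Finset.range (n k),
          (A.indicator (fun _ => (1 : ℝ)) (T^[i] z) - min (ε / 2) (1 / 2))) ∂μ := fun k φ hφ =>
      integral_map (hm k).aemeasurable hφ.aestronglyMeasurable
    obtain ⟨θ, hθ, hconv⟩ := exists_subseq_tendsto_of_tracks_enumeration (fun k => (he k).1) hfreq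
      (fun k => ⟨_, Measure.isProbabilityMeasure_map (μ := μ) (hm k).aemeasurable⟩)
      (fun φ K M hφ hM => by
        simpa only [ProbabilityMeasure.coe_mk, hmap _ φ hφ.continuous] using hlim φ K M hφ hM)
      ⟨ν, hν⟩
    refine ⟨n ∘ θ, hn.comp hθ, fun k => hn1 _, fun φ => ?_⟩
    exact (ProbabilityMeasure.tendsto_iff_forall_integral_tendsto.1 hconv φ).congr fun k =>
      hmap (θ k) φ φ.continuous
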